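/- Let A ∈ R^{m×n} have rank ρ, let k be an integer with 2 ≤ k < ρ, let p ≥ 2 and q ≥ 0 be integers, and set r = k + p. Let R ∈ R^{n×r} be a random matrix whose entries are independent standard Gaussian random variables, define B = (A Aᵀ)^q A, and set Y = B R ∈ R^{m×r}. Then E[ min { ‖A − X‖₂ : X ∈ R^{m×n}, rank(X) ≤ k, column space of X contained in column space of Y } ] ≤ (1 + √(k/(p−1)) + (e·√(k+p)/p)·√(min{m,n} − k))^{1/(2q+1)} · ‖A − A_k‖₂, where e = 2.718… is Euler's number. -/

import Mathlib

open Matrix MeasureTheory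

noncomputable def frobSq {m n : Type*} [Fintype m] [Fintype n] (A : Matrix m n ℝ) : ℝ :=
  ∑ i, ∑ j, A i j ^ 2

noncomputable def spec {m n : Type*} [Fintype m] [Fintype n] [DecidableEq n]
    (A : Matrix m n ℝ) : ℝ :=
  ‖LinearMap.toContinuousLinearMap (Matrix.toEuclideanLin A)‖

noncomputable def specErr {m n : Type*} [Fintype m] [Fintype n] [DecidableEq n]
    (A : Matrix m n ℝ) (k : ℕ) : ℝ :=
  sInf {e : ℝ | ∃ X : Matrix m n ℝ, X.rank ≤ k ∧ e = spec (A - X)}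

noncomputable def frobSqErr {m n : Type*} [Fintype m] [Fintype n]
    (A : Matrix m n ℝ) (k : ℕ) : ℝ :=
  sInf {e : ℝ | ∃ X : Matrix m n ℝ, X.rank ≤ k ∧ e = frobSq (A - X)}

noncomputable def specErrIn {m n r : Type*} [Fintype m] [Fintype n] [DecidableEq n]
    [Fintype r] (A : Matrix m n ℝ) (C : Matrix m r ℝ) (k : ℕ) : ℝ :=
  sInf {e : ℝ | ∃ X : Matrix m n ℝ, X.rank ≤ k ∧
    LinearMap.range X.mulVecLin ≤ LinearMap.range C.mulVecLin ∧ e = spec (A - X)}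

noncomputable def frobSqErrIn {m n r : Type*} [Fintype m] [Fintype n] [Fintype r]
    (A : Matrix m n ℝ) (C : Matrix m r ℝ) (k : ℕ) : ℝ :=
  sInf {e : ℝ | ∃ X : Matrix m n ℝ, X.rank ≤ k ∧
    LinearMap.range X.mulVecLin ≤ LinearMap.range C.mulVecLin ∧ e = frobSq (A - X)}

def IsMoorePenrose {m n : Type*} [Fintype m] [Fintype n]
    (M : Matrix m n ℝ) (P : Matrix n m ℝ) : Prop :=
  M * P * M = M ∧ P * M * P = P ∧ (M * P)ᵀ = M * P ∧ (P * M)ᵀ = P * M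

section Gaussian

open ProbabilityTheory Module

variable {E : Type*} [NormedAddCommGroup E] [InnerProductSpace ℝ E]

variable (E) in
/-- The density of the standard Gaussian measure. -/
noncomputable def stdGaussianPDF (x : E) : ℝ :=
  (2 * Real.pi) ^ (-(finrank ℝ E / 2 : ℝ)) * Real.exp (-(1 / 2) * ‖x‖ ^ 2)

theorem stdGaussianPDF_nonneg (x : E) : 0 ≤ stdGaussianPDF E x := by
  unfold stdGaussianPDF; positivity

theorem continuous_stdGaussianPDF : Continuous (stdGaussianPDF E) := by
  unfold stdGaussianPDF; fun_prop

theorem hasFDerivAt_stdGaussianPDF (x : E) :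
    HasFDerivAt (stdGaussianPDF E) ((-stdGaussianPDF E x) • innerSL ℝ x) x := by
  have h1 : HasFDerivAt (fun x : E => ‖x‖ ^ 2) (2 • innerSL ℝ x) x := by
    simpa using (hasStrictFDerivAt_norm_sq x).hasFDerivAt
  have h2 := ((h1.const_mul (-(1 / 2) : ℝ)).exp).const_mul
    ((2 * Real.pi) ^ (-(finrank ℝ E / 2 : ℝ)))
  refine h2.congr_fderiv ?_
  ext y
  simp [stdGaussianPDF]
  ring

variable [FiniteDimensional ℝ E] [MeasurableSpace E] [BorelSpace E]
  {F : Type*} [NormedAddCommGroup F] [InnerProductSpace ℝ F] [FiniteDimensional ℝ F]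
  [MeasurableSpace F] [BorelSpace F]

/-- A coisometry maps the standard Gaussian measure to the standard Gaussian measure. -/
theorem stdGaussian_map_of_norm_adjoint (L : E →L[ℝ] F)
    (hL : ∀ t, ‖ContinuousLinearMap.adjoint L t‖ = ‖t‖) :
    (stdGaussian E).map L = stdGaussian F := by
  apply Measure.ext_of_charFun
  ext t
  have h : charFun ((stdGaussian E).map L) t
      = charFun (stdGaussian E) (ContinuousLinearMap.adjoint L t) := by
    rw [charFun_apply, charFun_apply, integral_map L.continuous.aemeasurable (by fun_prop)]
    simp [ContinuousLinearMap.adjoint_inner_right]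
  rw [h, charFun_stdGaussian, charFun_stdGaussian, hL]

theorem integral_withDensity_stdGaussianPDF {G : Type*} [NormedAddCommGroup G] [NormedSpace ℝ G]
    (f : E → G) :
    ∫ x, f x ∂(volume.withDensity fun x => ENNReal.ofReal (stdGaussianPDF E x))
      = ∫ x, stdGaussianPDF E x • f x := by
  rw [integral_withDensity_eq_integral_toReal_smul]
  · simp [stdGaussianPDF_nonneg]
  · exact continuous_stdGaussianPDF.measurable.ennreal_ofReal
  · simp

theorem integrable_exp_neg_mul_sq_norm_half :
    Integrable (fun x : E => Real.exp (-(1 / 2) * ‖x‖ ^ 2)) := by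
  have := GaussianFourier.integrable_cexp_neg_mul_sq_norm_add (V := E) (b := 1 / 2)
    (by norm_num) 0 0
  refine this.norm.congr (ae_of_all _ fun x => ?_)
  simp [Complex.norm_exp, ← Complex.ofReal_pow]

theorem integrable_stdGaussianPDF : Integrable (stdGaussianPDF E) :=
  integrable_exp_neg_mul_sq_norm_half.const_mul _

theorem stdGaussian_eq_withDensity :
    stdGaussian E = volume.withDensity fun x => ENNReal.ofReal (stdGaussianPDF E x) := by
  have : IsFiniteMeasure (volume.withDensity fun x => ENNReal.ofReal (stdGaussianPDF E x)) :=
    isFiniteMeasure_withDensity_ofReal integrable_stdGaussianPDF.2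
  apply Measure.ext_of_charFun
  ext t
  rw [charFun_stdGaussian, charFun_apply, integral_withDensity_stdGaussianPDF]
  have := GaussianFourier.integral_cexp_neg_mul_sq_norm_add (V := E) (b := 1 / 2)
    (by norm_num) Complex.I t
  have h2 : ∀ x : E, stdGaussianPDF E x • Complex.exp (inner ℝ x t * Complex.I)
      = ((2 * Real.pi) ^ (-(finrank ℝ E / 2 : ℝ)) : ℝ) *
        Complex.exp (-(1 / 2) * ‖x‖ ^ 2 + Complex.I * inner ℝ t x) := by
    intro x
    rw [Complex.exp_add, stdGaussianPDF, real_inner_comm, mul_comm Complex.I]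
    simp [mul_assoc]
  simp_rw [h2]
  rw [integral_const_mul, this, ← mul_assoc]
  have h3 : (((2 * Real.pi) ^ (-(finrank ℝ E / 2 : ℝ)) : ℝ) : ℂ) *
      (Real.pi / (1 / 2) : ℂ) ^ (finrank ℝ E / 2 : ℂ) = 1 := by
    have : (Real.pi / (1 / 2) : ℂ) ^ (finrank ℝ E / 2 : ℂ)
        = (((2 * Real.pi) ^ (finrank ℝ E / 2 : ℝ) : ℝ) : ℂ) := by
      rw [Complex.ofReal_cpow (by positivity)]
      push_cast
      congr 1
      ring
    rw [this, ← Complex.ofReal_mul, ← Real.rpow_add (by positivity)]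
    simp
  rw [h3, one_mul]
  congr 1
  rw [Complex.I_sq]
  ring

/-- Moments of the norm of a standard Gaussian vector. -/
theorem lintegral_norm_rpow_stdGaussian [Nontrivial E] {a : ℝ} (ha : 0 < finrank ℝ E + a) :
    ∫⁻ x, ENNReal.ofReal (‖x‖ ^ a) ∂(stdGaussian E)
      = ENNReal.ofReal (2 ^ (a / 2) * Real.Gamma ((finrank ℝ E + a) / 2)
          / Real.Gamma (finrank ℝ E / 2)) := by
  have hd : 0 < finrank ℝ E := finrank_pos
  have hd1 : (1 : ℝ) ≤ finrank ℝ E := by exact_mod_cast hd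
  set c : ℝ := (2 * Real.pi) ^ (-(finrank ℝ E / 2 : ℝ)) with hc
  obtain ⟨C, hC⟩ : ∃ C : ℝ, ∀ f : ℝ → ℝ, ∫ x : E, f ‖x‖
      = C * ∫ y in Set.Ioi (0 : ℝ), y ^ (finrank ℝ E - 1) • f y :=
    ⟨finrank ℝ E * (volume : Measure E).real (Metric.ball 0 1), fun f => by
      rw [integral_fun_norm_addHaar]; simp [mul_assoc]⟩
  have key : ∀ b : ℝ, 0 < finrank ℝ E + b → ∫ x : E, ‖x‖ ^ b * stdGaussianPDF E x
      = C * c * (2 ^ ((finrank ℝ E + b) / 2) * (1 / 2) * Real.Gamma ((finrank ℝ E + b) / 2)) := by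
    intro b hb
    have h1 := hC (fun y => y ^ b * (c * Real.exp (-(1 / 2) * y ^ 2)))
    have h2 : ∫ y in Set.Ioi (0 : ℝ), y ^ (finrank ℝ E - 1) •
        (y ^ b * (c * Real.exp (-(1 / 2) * y ^ 2)))
        = c * ∫ y in Set.Ioi (0 : ℝ), y ^ (finrank ℝ E - 1 + b) *
          Real.exp (-(1 / 2) * y ^ (2 : ℝ)) := by
      rw [← integral_const_mul]
      refine setIntegral_congr_fun measurableSet_Ioi fun y hy => ?_
      have hy : 0 < y := hy
      simp only [smul_eq_mul]
      rw [Real.rpow_add hy, Real.rpow_two, ← Nat.cast_pred hd, Real.rpow_natCast]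
      ring
    rw [h2, integral_rpow_mul_exp_neg_mul_rpow (by norm_num) (by linarith) (by norm_num)] at h1
    simp only [stdGaussianPDF]
    rw [h1, one_div, Real.inv_rpow (by norm_num), ← Real.rpow_neg (by norm_num)]
    rw [show -(-((finrank ℝ E : ℝ) - 1 + b + 1) / 2) = ((finrank ℝ E : ℝ) + b) / 2 by ring,
      show ((finrank ℝ E : ℝ) - 1 + b + 1) = (finrank ℝ E : ℝ) + b by ring]
    ring
  have hfi : Integrable (fun x : E => ‖x‖ ^ a * stdGaussianPDF E x) := by
    refine (integrable_fun_norm_addHaar (E := E) volume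
      (f := fun y => y ^ a * (c * Real.exp (-(1 / 2) * y ^ 2)))).2 ?_
    refine IntegrableOn.congr_fun ((integrableOn_rpow_mul_exp_neg_mul_sq (b := 1 / 2) (by norm_num)
      (s := finrank ℝ E - 1 + a) (by linarith)).const_mul c) (fun y hy => ?_)
      measurableSet_Ioi
    have hy : 0 < y := hy
    simp only [smul_eq_mul]
    rw [Real.rpow_add hy, ← Nat.cast_pred hd, Real.rpow_natCast]
    ring
  have k0 := key 0 (by linarith)
  have ka := key a ha
  have h0 : ∫ x : E, ‖x‖ ^ (0 : ℝ) * stdGaussianPDF E x = 1 := by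
    have : ∫ x, (1 : ℝ) ∂(stdGaussian E) = 1 := by simp
    rw [stdGaussian_eq_withDensity, integral_withDensity_stdGaussianPDF] at this
    simpa using this
  rw [h0] at k0
  simp only [add_zero] at k0
  have hG : 0 < Real.Gamma (finrank ℝ E / 2) := Real.Gamma_pos_of_pos (by linarith)
  rw [stdGaussian_eq_withDensity, lintegral_withDensity_eq_lintegral_mul₀
    continuous_stdGaussianPDF.measurable.ennreal_ofReal.aemeasurable
    (by fun_prop)]
  have : ∀ x : E, ((fun x : E => ENNReal.ofReal (stdGaussianPDF E x)) *
      (fun x : E => ENNReal.ofReal (‖x‖ ^ a)) : E → ENNReal) x =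
          ENNReal.ofReal (‖x‖ ^ a * stdGaussianPDF E x) := by
    intro x
    simp only [Pi.mul_apply]
    rw [← ENNReal.ofReal_mul (stdGaussianPDF_nonneg x), mul_comm]
  simp_rw [this]
  rw [← ofReal_integral_eq_lintegral_ofReal hfi
    (ae_of_all _ fun x => mul_nonneg (by positivity) (stdGaussianPDF_nonneg x)), ka]
  congr 1
  rw [add_div, Real.rpow_add (by norm_num)]
  rw [eq_div_iff hG.ne']
  linear_combination (-(2 : ℝ) ^ (a / 2) * Real.Gamma ((finrank ℝ E : ℝ) / 2 + a / 2)) * k0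

theorem integrable_norm_stdGaussian : Integrable (fun x : E => ‖x‖) (stdGaussian E) :=
  IsGaussian.integrable_id.norm

theorem integrable_stdGaussian_iff {f : E → ℝ} :
    Integrable f (stdGaussian E) ↔ Integrable (fun x => f x * stdGaussianPDF E x) := by
  rw [stdGaussian_eq_withDensity, integrable_withDensity_iff
    continuous_stdGaussianPDF.measurable.ennreal_ofReal (by simp)]
  simp [stdGaussianPDF_nonneg]

/-- Gaussian integration by parts. -/
theorem integral_mul_inner_stdGaussian {f : E → ℝ} (c : E) {K₀ K₁ : ℝ}
    (hf : Differentiable ℝ f) (h0 : ∀ x, |f x| ≤ K₀) (h1 : ∀ x, |fderiv ℝ f x c| ≤ K₁) :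
    ∫ x, f x * inner ℝ c x ∂(stdGaussian E) = ∫ x, fderiv ℝ f x c ∂(stdGaussian E) := by
  have hm1 : Measurable fun x => fderiv ℝ f x c := measurable_fderiv_apply_const ℝ f c
  have i1 : Integrable (fun x => fderiv ℝ f x c) (stdGaussian E) :=
    Integrable.of_bound hm1.aestronglyMeasurable K₁ (ae_of_all _ h1)
  have i2 : Integrable (fun x => f x * inner ℝ c x) (stdGaussian E) := by
    refine (integrable_norm_stdGaussian.const_mul (K₀ * ‖c‖)).mono'
      (by have := hf.continuous; fun_prop) (ae_of_all _ fun x => ?_)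
    rw [norm_mul, mul_assoc]
    exact mul_le_mul (h0 x) (norm_inner_le_norm c x) (norm_nonneg _)
      ((abs_nonneg _).trans (h0 x))
  have i3 : Integrable f (stdGaussian E) :=
    Integrable.of_bound hf.continuous.aestronglyMeasurable K₀ (ae_of_all _ h0)
  have d : ∀ x, fderiv ℝ (stdGaussianPDF E) x c = -(stdGaussianPDF E x * inner ℝ c x) := by
    intro x
    rw [(hasFDerivAt_stdGaussianPDF x).fderiv]
    simp [real_inner_comm]
  have := integral_mul_fderiv_eq_neg_fderiv_mul_of_integrable (μ := volume) (f := f)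
    (g := stdGaussianPDF E) (v := c) (integrable_stdGaussian_iff.1 i1)
    (by
      simp_rw [d]
      refine (integrable_stdGaussian_iff.1 i2).neg.congr (ae_of_all _ fun x => ?_)
      simp; ring)
    (integrable_stdGaussian_iff.1 i3) (fun x _ => hf x)
    (fun x _ => (hasFDerivAt_stdGaussianPDF x).differentiableAt)
  rw [stdGaussian_eq_withDensity, integral_withDensity_stdGaussianPDF,
    integral_withDensity_stdGaussianPDF]
  simp_rw [d] at this
  simp only [smul_eq_mul]
  simp only [mul_neg, integral_neg, neg_inj] at this
  rw [show (fun x => stdGaussianPDF E x * (f x * inner ℝ c x))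
    = fun x => f x * (stdGaussianPDF E x * inner ℝ c x) from by ext; ring, this]
  simp [mul_comm]

end Gaussian

section SudakovFernique

open ProbabilityTheory Module

theorem sum_mul_diag_sub_nonneg {ι : Type*} [Fintype ι] (p : ι → ℝ) (D : ι → ι → ℝ)
    (hp : ∀ i, 0 ≤ p i) (hp1 : ∑ i, p i = 1) (hD : ∀ i j, 0 ≤ D i i + D j j - D i j - D j i) :
    0 ≤ ∑ i, p i * (D i i - ∑ j, p j * D j i) := by
  have h1 : ∑ i, p i * D i i = ∑ i, ∑ j, p i * p j * D i i := by
    refine Finset.sum_congr rfl fun i _ => ?_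
    rw [← Finset.sum_mul, ← Finset.mul_sum, hp1, mul_one]
  have h2 : ∑ i, p i * D i i = ∑ i, ∑ j, p i * p j * D j j := by
    rw [h1, Finset.sum_comm]
    exact Finset.sum_congr rfl fun i _ => Finset.sum_congr rfl fun j _ => by ring
  have h3 : ∑ i, p i * ∑ j, p j * D j i = ∑ i, ∑ j, p i * p j * D j i := by
    refine Finset.sum_congr rfl fun i _ => ?_
    rw [Finset.mul_sum]
    exact Finset.sum_congr rfl fun j _ => by ring
  have h4 : ∑ i, p i * ∑ j, p j * D j i = ∑ i, ∑ j, p i * p j * D i j := by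
    rw [h3, Finset.sum_comm]
    exact Finset.sum_congr rfl fun i _ => Finset.sum_congr rfl fun j _ => by ring
  have h5 : 0 ≤ ∑ i, ∑ j, p i * p j * (D i i + D j j - D i j - D j i) :=
    Finset.sum_nonneg fun i _ => Finset.sum_nonneg fun j _ =>
      mul_nonneg (mul_nonneg (hp i) (hp j)) (hD i j)
  simp only [mul_add, mul_sub, Finset.sum_add_distrib, Finset.sum_sub_distrib] at h5 ⊢
  linarith

variable {E : Type*} [NormedAddCommGroup E] [InnerProductSpace ℝ E]
variable {ι : Type*} [Fintype ι]

/-- The log-sum-exp of the linear functionals represented by a finite family of vectors. -/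
noncomputable def logSumExp (c : ι → E) (x : E) : ℝ :=
  Real.log (∑ i, Real.exp (inner ℝ (c i) x))

/-- The softmax weights of a finite family of linear functionals. -/
noncomputable def softmax (c : ι → E) (i : ι) (x : E) : ℝ :=
  Real.exp (inner ℝ (c i) x) / ∑ j, Real.exp (inner ℝ (c j) x)

theorem softmax_nonneg (c : ι → E) (i : ι) (x : E) : 0 ≤ softmax c i x := by
  unfold softmax; positivity

theorem sum_exp_pos [Nonempty ι] (f : ι → ℝ) : 0 < ∑ i, Real.exp (f i) :=
  Finset.sum_pos (fun _ _ => Real.exp_pos _) Finset.univ_nonempty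

theorem sum_softmax [Nonempty ι] (c : ι → E) (x : E) : ∑ i, softmax c i x = 1 := by
  unfold softmax
  rw [← Finset.sum_div, div_self (sum_exp_pos _).ne']

theorem softmax_le_one [Nonempty ι] (c : ι → E) (i : ι) (x : E) : softmax c i x ≤ 1 := by
  rw [← sum_softmax c x]
  exact Finset.single_le_sum (fun j _ => softmax_nonneg c j x) (Finset.mem_univ i)

theorem abs_sum_softmax_mul_le [Nonempty ι] (c : ι → E) (x : E) (f : ι → ℝ) {K : ℝ}
    (hf : ∀ i, |f i| ≤ K) : |∑ i, softmax c i x * f i| ≤ K := by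
  calc |∑ i, softmax c i x * f i| ≤ ∑ i, |softmax c i x * f i| := Finset.abs_sum_le_sum_abs _ _
    _ ≤ ∑ i, softmax c i x * K := by
        refine Finset.sum_le_sum fun i _ => ?_
        rw [abs_mul, abs_of_nonneg (softmax_nonneg c i x)]
        exact mul_le_mul_of_nonneg_left (hf i) (softmax_nonneg c i x)
    _ = K := by rw [← Finset.sum_mul, sum_softmax, one_mul]

theorem hasFDerivAt_softmax [Nonempty ι] (c : ι → E) (i : ι) (x : E) :
    HasFDerivAt (softmax c i) (softmax c i x • (innerSL ℝ (c i) -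
      ∑ j, softmax c j x • innerSL ℝ (c j))) x := by
  have h1 : ∀ j, HasFDerivAt (fun x => Real.exp (inner ℝ (c j) x))
      (Real.exp (inner ℝ (c j) x) • innerSL ℝ (c j)) x := fun j =>
    ((innerSL ℝ (c j)).hasFDerivAt (x := x)).exp
  have h2 : HasFDerivAt (fun x => ∑ j, Real.exp (inner ℝ (c j) x))
      (∑ j, Real.exp (inner ℝ (c j) x) • innerSL ℝ (c j)) x :=
    HasFDerivAt.fun_sum fun j _ => h1 j
  have hS := (sum_exp_pos fun j => inner ℝ (c j) x).ne'
  have h3 : HasFDerivAt (softmax c i) _ x := (h1 i).mul ((hasDerivAt_inv hS).comp_hasFDerivAt x h2)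
  refine h3.congr_fderiv ?_
  ext v
  simp only [softmax, _root_.smul_apply, _root_.sub_apply, _root_.add_apply, _root_.sum_apply,
    smul_eq_mul, innerSL_apply_apply]
  have : ∑ j, Real.exp (inner ℝ (c j) x) / (∑ k, Real.exp (inner ℝ (c k) x)) * inner ℝ (c j) v
      = (∑ j, Real.exp (inner ℝ (c j) x) * inner ℝ (c j) v) /
        ∑ k, Real.exp (inner ℝ (c k) x) := by
    rw [Finset.sum_div]
    exact Finset.sum_congr rfl fun j _ => by ring
  rw [this]
  field_simp
  ring

theorem abs_logSumExp_le [Nonempty ι] (c : ι → E) (x : E) {K : ℝ} (hK : ∀ i, ‖c i‖ ≤ K) :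
    |logSumExp c x| ≤ K * ‖x‖ + Real.log (Fintype.card ι) := by
  have hc : ∀ i, |inner ℝ (c i) x| ≤ K * ‖x‖ := fun i =>
    (abs_real_inner_le_norm _ _).trans (mul_le_mul_of_nonneg_right (hK i) (norm_nonneg x))
  have hcard : (1 : ℝ) ≤ Fintype.card ι := by exact_mod_cast Fintype.card_pos
  have hlog := Real.log_nonneg hcard
  unfold logSumExp
  rw [abs_le]
  constructor
  · obtain ⟨i⟩ := ‹Nonempty ι›
    have : Real.exp (inner ℝ (c i) x) ≤ ∑ i, Real.exp (inner ℝ (c i) x) :=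
      Finset.single_le_sum (f := fun i => Real.exp (inner ℝ (c i) x))
        (fun j _ => (Real.exp_pos _).le) (Finset.mem_univ i)
    have := Real.log_le_log (Real.exp_pos _) this
    rw [Real.log_exp] at this
    have := (abs_le.1 (hc i)).1
    linarith
  · have : ∑ i, Real.exp (inner ℝ (c i) x) ≤ Fintype.card ι * Real.exp (K * ‖x‖) := by
      calc _ ≤ ∑ _i : ι, Real.exp (K * ‖x‖) :=
            Finset.sum_le_sum fun i _ => Real.exp_le_exp.2 (abs_le.1 (hc i)).2
        _ = _ := by simp
    have := Real.log_le_log (sum_exp_pos _) this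
    rw [Real.log_mul (by positivity) (by positivity), Real.log_exp] at this
    linarith

theorem continuous_logSumExp [Nonempty ι] (c : ι → E) : Continuous (logSumExp c) := by
  unfold logSumExp
  exact Continuous.log (by fun_prop) fun x => (sum_exp_pos _).ne'

variable [FiniteDimensional ℝ E] [MeasurableSpace E] [BorelSpace E]

theorem integrable_logSumExp [Nonempty ι] (c : ι → E) :
    Integrable (logSumExp c) (stdGaussian E) := by
  refine ((integrable_norm_stdGaussian.const_mul (∑ i, ‖c i‖)).add
    (integrable_const (Real.log (Fintype.card ι)))).mono'
    (continuous_logSumExp c).aestronglyMeasurable (ae_of_all _ fun x => ?_)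
  exact abs_logSumExp_le c x fun i =>
    Finset.single_le_sum (f := fun i => ‖c i‖) (fun j _ => norm_nonneg _) (Finset.mem_univ i)

/-- The Sudakov–Fernique comparison inequality, in log-sum-exp form. -/
theorem integral_logSumExp_le [Nonempty ι] (a b : ι → E) (hab : ∀ i j, inner ℝ (a i) (b j) = 0)
    (h : ∀ i j, ‖a i - a j‖ ≤ ‖b i - b j‖) :
    ∫ x, logSumExp a x ∂(stdGaussian E) ≤ ∫ x, logSumExp b x ∂(stdGaussian E) := by
  set c : ℝ → ι → E := fun t i => Real.cos t • a i + Real.sin t • b i with hc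
  set c' : ℝ → ι → E := fun t i => -Real.sin t • a i + Real.cos t • b i with hc'
  set M : ℝ := ∑ i, (‖a i‖ + ‖b i‖) with hM
  have hMi : ∀ i, ‖a i‖ + ‖b i‖ ≤ M := fun i =>
    Finset.single_le_sum (f := fun i => ‖a i‖ + ‖b i‖) (fun j _ => by positivity)
      (Finset.mem_univ i)
  have bound : ∀ (s t : ℝ) i, |s| ≤ 1 → |t| ≤ 1 → ‖s • a i + t • b i‖ ≤ M := by
    intro s t i hs ht
    refine (norm_add_le _ _).trans (le_trans ?_ (hMi i))
    rw [norm_smul, norm_smul, Real.norm_eq_abs, Real.norm_eq_abs]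
    gcongr
    · exact mul_le_of_le_one_left (norm_nonneg _) hs
    · exact mul_le_of_le_one_left (norm_nonneg _) ht
  have hcM : ∀ t i, ‖c t i‖ ≤ M := fun t i =>
    bound _ _ i (Real.abs_cos_le_one t) (Real.abs_sin_le_one t)
  have hcM' : ∀ t i, ‖c' t i‖ ≤ M := fun t i =>
    bound _ _ i (by simpa using Real.abs_sin_le_one t) (Real.abs_cos_le_one t)
  have hder : ∀ t x, HasDerivAt (fun t => logSumExp (c t) x)
      (∑ i, softmax (c t) i x * inner ℝ (c' t i) x) t := by
    intro t x
    have h1 : ∀ i, HasDerivAt (fun t => inner ℝ (c t i) x) (inner ℝ (c' t i) x) t := by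
      intro i
      have := (((Real.hasDerivAt_cos t).smul_const (a i)).add
        ((Real.hasDerivAt_sin t).smul_const (b i))).inner ℝ (hasDerivAt_const t x)
      simpa [hc, hc'] using this
    have h2 : HasDerivAt (fun t => ∑ i, Real.exp (inner ℝ (c t i) x))
        (∑ i, Real.exp (inner ℝ (c t i) x) * inner ℝ (c' t i) x) t :=
      HasDerivAt.fun_sum fun i _ => (h1 i).exp
    have h3 := h2.log (sum_exp_pos _).ne'
    refine h3.congr_deriv ?_
    rw [Finset.sum_div]
    exact Finset.sum_congr rfl fun i _ => by unfold softmax; ring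
  have hcont : ∀ t i, Continuous (softmax (c t) i) := fun t i =>
    continuous_iff_continuousAt.2 fun x => (hasFDerivAt_softmax (c t) i x).continuousAt
  have hφ : ∀ t, HasDerivAt (fun t => ∫ x, logSumExp (c t) x ∂(stdGaussian E))
      (∫ x, ∑ i, softmax (c t) i x * inner ℝ (c' t i) x ∂(stdGaussian E)) t := by
    intro t
    refine (hasDerivAt_integral_of_dominated_loc_of_deriv_le
      (bound := fun x => M * ‖x‖) (s := Set.univ) Filter.univ_mem
      (Filter.Eventually.of_forall fun t => (continuous_logSumExp _).aestronglyMeasurable)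
      (integrable_logSumExp _)
      (Continuous.aestronglyMeasurable (by
        have := hcont t
        fun_prop)) (ae_of_all _ fun x t _ => ?_)
      (integrable_norm_stdGaussian.const_mul M) (ae_of_all _ fun x t _ => hder t x)).2
    rw [Real.norm_eq_abs]
    refine abs_sum_softmax_mul_le _ _ _ fun i => ?_
    exact (abs_real_inner_le_norm _ _).trans
      (mul_le_mul_of_nonneg_right (hcM' t i) (norm_nonneg x))
  have hsoft : ∀ t i x v, fderiv ℝ (softmax (c t) i) x v
      = softmax (c t) i x * (inner ℝ (c t i) v - ∑ j, softmax (c t) j x * inner ℝ (c t j) v) := by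
    intro t i x v
    rw [(hasFDerivAt_softmax (c t) i x).fderiv]
    simp
  have hsoftb : ∀ t i x v, |fderiv ℝ (softmax (c t) i) x v| ≤ M * ‖v‖ + M * ‖v‖ := by
    intro t i x v
    rw [hsoft, abs_mul, abs_of_nonneg (softmax_nonneg _ _ _)]
    have hb : ∀ j, |inner ℝ (c t j) v| ≤ M * ‖v‖ := fun j =>
      (abs_real_inner_le_norm _ _).trans (mul_le_mul_of_nonneg_right (hcM t j) (norm_nonneg v))
    refine (mul_le_of_le_one_left (abs_nonneg _) (softmax_le_one _ _ _)).trans ?_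
    exact (abs_sub _ _).trans (add_le_add (hb i) (abs_sum_softmax_mul_le _ _ _ hb))
  have hφ' : ∀ t ∈ Set.Icc 0 (Real.pi / 2),
      0 ≤ ∫ x, ∑ i, softmax (c t) i x * inner ℝ (c' t i) x ∂(stdGaussian E) := by
    intro t ht
    have hfi : ∀ i, Integrable (fun x => softmax (c t) i x * inner ℝ (c' t i) x)
        (stdGaussian E) := by
      intro i
      refine (integrable_norm_stdGaussian.const_mul M).mono'
        (Continuous.aestronglyMeasurable (by have := hcont t i; fun_prop))
        (ae_of_all _ fun x => ?_)
      rw [Real.norm_eq_abs, abs_mul, abs_of_nonneg (softmax_nonneg _ _ _)]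
      refine (mul_le_of_le_one_left (abs_nonneg _) (softmax_le_one _ _ _)).trans ?_
      exact (abs_real_inner_le_norm _ _).trans
        (mul_le_mul_of_nonneg_right (hcM' t i) (norm_nonneg x))
    have hfi' : ∀ i, Integrable (fun x => fderiv ℝ (softmax (c t) i) x (c' t i))
        (stdGaussian E) := fun i =>
      Integrable.of_bound (measurable_fderiv_apply_const ℝ _ _).aestronglyMeasurable
        (M * ‖c' t i‖ + M * ‖c' t i‖) (ae_of_all _ fun x => hsoftb t i x _)
    rw [integral_finsetSum _ fun i _ => hfi i]
    have : ∀ i, ∫ x, softmax (c t) i x * inner ℝ (c' t i) x ∂(stdGaussian E)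
        = ∫ x, fderiv ℝ (softmax (c t) i) x (c' t i) ∂(stdGaussian E) := by
      intro i
      refine integral_mul_inner_stdGaussian (K₀ := 1) (K₁ := M * ‖c' t i‖ + M * ‖c' t i‖) (c' t i)
        (fun x => (hasFDerivAt_softmax (c t) i x).differentiableAt) (fun x => ?_)
        (fun x => hsoftb t i x _)
      rw [abs_of_nonneg (softmax_nonneg _ _ _)]
      exact softmax_le_one _ _ _
    simp_rw [this]
    rw [← integral_finsetSum _ fun i _ => hfi' i]
    refine integral_nonneg fun x => ?_
    simp only [Pi.zero_apply, hsoft]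
    refine sum_mul_diag_sub_nonneg (fun i => softmax (c t) i x)
      (fun j i => inner ℝ (c t j) (c' t i)) (fun i => softmax_nonneg _ _ _) (sum_softmax _ _)
      fun i j => ?_
    have hsc : 0 ≤ Real.sin t * Real.cos t :=
      mul_nonneg (Real.sin_nonneg_of_nonneg_of_le_pi ht.1 (by linarith [ht.2, Real.pi_pos]))
        (Real.cos_nonneg_of_neg_pi_div_two_le_of_le (by linarith [ht.1, Real.pi_pos]) ht.2)
    have hin : ∀ i j, inner ℝ (c t i) (c' t j)
        = Real.sin t * Real.cos t * (inner ℝ (b i) (b j) - inner ℝ (a i) (a j)) := by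
      intro i j
      have h1 := hab i j
      have h2 : inner ℝ (b i) (a j) = 0 := by rw [real_inner_comm]; exact hab j i
      simp only [hc, hc', inner_add_left, inner_add_right, inner_smul_left, inner_smul_right, h1,
        h2]
      simp
      ring
    simp only [hin]
    have h1 := pow_le_pow_left₀ (norm_nonneg _) (h i j) 2
    rw [norm_sub_sq_real, norm_sub_sq_real] at h1
    rw [real_inner_comm (b i) (b j), real_inner_comm (a i) (a j)]
    simp only [real_inner_self_eq_norm_sq]
    nlinarith [mul_nonneg hsc (sub_nonneg.2 h1)]
  have hmono : MonotoneOn (fun t => ∫ x, logSumExp (c t) x ∂(stdGaussian E))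
      (Set.Icc 0 (Real.pi / 2)) := by
    refine monotoneOn_of_deriv_nonneg (convex_Icc _ _)
      (fun t _ => (hφ t).continuousAt.continuousWithinAt)
      (fun t _ => (hφ t).differentiableAt.differentiableWithinAt) fun t ht => ?_
    rw [(hφ t).deriv]
    exact hφ' t (interior_subset ht)
  have hpi := Real.pi_pos
  have := hmono (Set.left_mem_Icc.2 (by positivity)) (Set.right_mem_Icc.2 (by positivity))
    (by positivity)
  simpa [hc] using this

end SudakovFernique

section GaussianMatrix

open ProbabilityTheory Module

variable {E : Type*} [NormedAddCommGroup E] [InnerProductSpace ℝ E] [FiniteDimensional ℝ E]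
  [MeasurableSpace E] [BorelSpace E]

/-- The law of a vector with independent standard Gaussian entries. -/
noncomputable abbrev gaussianVec (ι : Type*) [Fintype ι] : Measure (ι → ℝ) :=
  Measure.pi fun _ => gaussianReal 0 1

/-- The law of a matrix with independent standard Gaussian entries. -/
noncomputable abbrev gaussianMat (ι κ : Type*) [Fintype ι] [Fintype κ] : Measure (ι → κ → ℝ) :=
  Measure.pi fun _ => gaussianVec κ

theorem map_inner_stdGaussian {ι : Type*} [Fintype ι] {e : ι → E} (he : Orthonormal ℝ e) :
    (stdGaussian E).map (fun x i => inner ℝ (e i) x) = gaussianVec ι := by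
  classical
  let L : E →L[ℝ] EuclideanSpace ℝ ι :=
    (PiLp.continuousLinearEquiv 2 ℝ (fun _ : ι => ℝ)).symm.toContinuousLinearMap ∘L
      ContinuousLinearMap.pi fun i => innerSL ℝ (e i)
  have hadj : ∀ t, ContinuousLinearMap.adjoint L t = ∑ i, t i • e i := by
    intro t
    refine ext_inner_left ℝ fun x => ?_
    rw [ContinuousLinearMap.adjoint_inner_right]
    simp [L, PiLp.inner_apply, inner_sum, inner_smul_right, real_inner_comm]
  have hmap : (stdGaussian E).map L = stdGaussian (EuclideanSpace ℝ ι) := by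
    refine stdGaussian_map_of_norm_adjoint L fun t => ?_
    rw [hadj, ← sq_eq_sq₀ (norm_nonneg _) (norm_nonneg _), ← real_inner_self_eq_norm_sq,
      he.inner_sum, EuclideanSpace.real_norm_sq_eq]
    simp [sq]
  have h2 : (stdGaussian (EuclideanSpace ℝ ι)).map (WithLp.ofLp) = gaussianVec ι := by
    rw [← map_pi_eq_stdGaussian, Measure.map_map (by fun_prop) (by fun_prop)]
    exact Measure.map_id
  rw [← h2, ← hmap, Measure.map_map (by fun_prop) (by fun_prop)]
  rfl

theorem map_inner_stdGaussian_mat {ι κ : Type*} [Fintype ι] [Fintype κ] {e : ι × κ → E}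
    (he : Orthonormal ℝ e) :
    (stdGaussian E).map (fun x i k => inner ℝ (e (i, k)) x) = gaussianMat ι κ := by
  have h := Measure.infinitePi_map_curry (ι := ι) (κ := κ) (X := ℝ)
    (fun _ _ => gaussianReal 0 1)
  simp only [Measure.infinitePi_eq_pi] at h
  have h2 := map_inner_stdGaussian he
  rw [gaussianVec] at h2
  rw [gaussianMat, ← h, ← h2, Measure.map_map (by fun_prop) (by fun_prop)]
  rfl

theorem integral_inner_sq_stdGaussian (y : E) :
    ∫ x, inner ℝ y x ^ 2 ∂(stdGaussian E) = ‖y‖ ^ 2 := by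
  have h := variance_dual_stdGaussian (innerSL ℝ y)
  rw [variance_eq_integral (by fun_prop), integral_strongDual_stdGaussian] at h
  simpa using h

theorem integrable_inner_sq_stdGaussian (y : E) :
    Integrable (fun x => inner ℝ y x ^ 2) (stdGaussian E) := by
  have h : MemLp (fun x : E => x) 2 (stdGaussian E) := IsGaussian.memLp_two_id
  have := (h.norm.integrable_sq).const_mul (‖y‖ ^ 2)
  refine this.mono' (by fun_prop) (ae_of_all _ fun x => ?_)
  rw [norm_pow, ← mul_pow]
  exact pow_le_pow_left₀ (norm_nonneg _) (norm_inner_le_norm y x) 2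

/-- The mean Euclidean length of a Gaussian vector is at most the square root of its variance. -/
theorem integral_sqrt_sum_inner_sq_le {ι : Type*} [Fintype ι] (y : ι → E) :
    Integrable (fun x => √(∑ i, inner ℝ (y i) x ^ 2)) (stdGaussian E) ∧
    ∫ x, √(∑ i, inner ℝ (y i) x ^ 2) ∂(stdGaussian E) ≤ √(∑ i, ‖y i‖ ^ 2) := by
  have hi : Integrable (fun x => ∑ i, inner ℝ (y i) x ^ 2) (stdGaussian E) :=
    integrable_finsetSum _ fun i _ => integrable_inner_sq_stdGaussian (y i)
  have h0 : ∀ x, 0 ≤ ∑ i, inner ℝ (y i) x ^ 2 := fun x => by positivity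
  have hI : Integrable (fun x => √(∑ i, inner ℝ (y i) x ^ 2)) (stdGaussian E) := by
    refine (hi.add (integrable_const 1)).mono' (by fun_prop) (ae_of_all _ fun x => ?_)
    rw [Real.norm_eq_abs, abs_of_nonneg (Real.sqrt_nonneg _)]
    simp only [Pi.add_apply]
    rw [Real.sqrt_le_left (by linarith [h0 x])]
    nlinarith [h0 x]
  refine ⟨hI, Real.le_sqrt_of_sq_le ?_⟩
  have hs : ∫ x, √(∑ i, inner ℝ (y i) x ^ 2) ^ 2 ∂(stdGaussian E) = ∑ i, ‖y i‖ ^ 2 := by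
    simp_rw [Real.sq_sqrt (h0 _)]
    rw [integral_finsetSum _ fun i _ => integrable_inner_sq_stdGaussian (y i)]
    simp_rw [integral_inner_sq_stdGaussian]
  have hv := variance_nonneg (fun x => √(∑ i, inner ℝ (y i) x ^ 2)) (stdGaussian E)
  rw [variance_eq_sub] at hv
  · simp only [Pi.pow_apply] at hv
    rw [hs] at hv
    linarith
  · refine (memLp_two_iff_integrable_sq (by fun_prop)).2 ?_
    simp_rw [Real.sq_sqrt (h0 _)]
    exact hi

end GaussianMatrix

section Chevet

open ProbabilityTheory Module

variable {E : Type*} [NormedAddCommGroup E] [InnerProductSpace ℝ E] [FiniteDimensional ℝ E]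
  [MeasurableSpace E] [BorelSpace E]

theorem exists_norm_eq_one_inner_eq_norm {F : Type*} [NormedAddCommGroup F]
    [InnerProductSpace ℝ F] [Nontrivial F] (w : F) : ∃ u : F, ‖u‖ = 1 ∧ inner ℝ u w = ‖w‖ := by
  by_cases hw : w = 0
  · obtain ⟨u, hu⟩ := exists_norm_eq F (zero_le_one' ℝ)
    exact ⟨u, hu, by simp [hw]⟩
  · have h0 : ‖w‖ ≠ 0 := norm_ne_zero_iff.2 hw
    refine ⟨‖w‖⁻¹ • w, by simp [norm_smul, h0], ?_⟩
    rw [real_inner_smul_left, real_inner_self_eq_norm_sq]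
    field_simp

/-- The Sudakov-Fernique comparison inequality, in the form of a bound on any variable dominated
by the first maximum in terms of any variable dominating the second maximum. -/
theorem integral_le_of_sudakovFernique {ι : Type*} [Fintype ι] [Nonempty ι] (a b : ι → E)
    (hab : ∀ i j, inner ℝ (a i) (b j) = 0) (h : ∀ i j, ‖a i - a j‖ ≤ ‖b i - b j‖)
    {f g : E → ℝ} (hf : Integrable f (stdGaussian E)) (hg : Integrable g (stdGaussian E))
    (hfa : ∀ x, ∃ i, f x ≤ inner ℝ (a i) x) (hgb : ∀ x i, inner ℝ (b i) x ≤ g x) :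
    ∫ x, f x ∂(stdGaussian E) ≤ ∫ x, g x ∂(stdGaussian E) := by
  set c := Real.log (Fintype.card ι)
  have key : ∀ β : ℝ, 0 < β →
      ∫ x, f x ∂(stdGaussian E) ≤ ∫ x, g x ∂(stdGaussian E) + c / β := by
    intro β hβ
    have h1 := integral_logSumExp_le (fun i => β • a i) (fun i => β • b i)
      (fun i j => by simp [real_inner_smul_left, inner_smul_right, hab])
      (fun i j => by
        rw [← smul_sub, ← smul_sub, norm_smul, norm_smul]
        exact mul_le_mul_of_nonneg_left (h i j) (norm_nonneg _))
    have h2 : ∫ x, β * f x ∂(stdGaussian E) ≤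
        ∫ x, logSumExp (fun i => β • a i) x ∂(stdGaussian E) := by
      refine integral_mono (hf.const_mul _) (integrable_logSumExp _) fun x => ?_
      obtain ⟨i, hi⟩ := hfa x
      refine (mul_le_mul_of_nonneg_left hi hβ.le).trans ?_
      rw [logSumExp, Real.le_log_iff_exp_le (sum_exp_pos _)]
      refine le_trans (le_of_eq ?_) (Finset.single_le_sum
        (f := fun i => Real.exp (inner ℝ (β • a i) x)) (fun j _ => (Real.exp_pos _).le)
        (Finset.mem_univ i))
      simp [real_inner_smul_left]
    have h3 : ∫ x, logSumExp (fun i => β • b i) x ∂(stdGaussian E) ≤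
        ∫ x, (β * g x + c) ∂(stdGaussian E) := by
      refine integral_mono (integrable_logSumExp _)
        ((hg.const_mul _).add (integrable_const _)) fun x => ?_
      rw [logSumExp, Real.log_le_iff_le_exp (sum_exp_pos _), add_comm, Real.exp_add,
        Real.exp_log (by positivity)]
      refine (Finset.sum_le_card_nsmul _ _ (Real.exp (β * g x)) fun i _ => ?_).trans
        (by simp [nsmul_eq_mul])
      rw [Real.exp_le_exp, real_inner_smul_left]
      exact mul_le_mul_of_nonneg_left (hgb x i) hβ.le
    rw [integral_const_mul] at h2
    rw [integral_add (hg.const_mul _) (integrable_const _), integral_const_mul] at h3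
    simp only [integral_const, probReal_univ, one_smul] at h3
    have := h2.trans (h1.trans h3)
    rw [← sub_nonneg] at this ⊢
    have e : ∫ x, g x ∂(stdGaussian E) + c / β - ∫ x, f x ∂(stdGaussian E) =
      (β * ∫ x, g x ∂(stdGaussian E) + c - β * ∫ x, f x ∂(stdGaussian E)) / β := by
      field_simp
    rw [e]
    positivity
  have ht : Filter.Tendsto (fun β : ℝ => ∫ x, g x ∂(stdGaussian E) + c / β) Filter.atTop
      (nhds (∫ x, g x ∂(stdGaussian E) + 0)) :=
    tendsto_const_nhds.add (tendsto_const_nhds.div_atTop Filter.tendsto_id)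
  rw [add_zero] at ht
  exact ge_of_tendsto ht ((Filter.eventually_gt_atTop 0).mono key)

/-- Finite nets on the unit sphere. -/
theorem exists_finite_net_sphere (F : Type*) [NormedAddCommGroup F] [NormedSpace ℝ F]
    [FiniteDimensional ℝ F] [Nontrivial F] {ε : ℝ} (hε : 0 < ε) :
    ∃ s : Finset F, s.Nonempty ∧ (∀ u ∈ s, ‖u‖ = 1) ∧
      ∀ u, ‖u‖ = 1 → ∃ v ∈ s, ‖u - v‖ ≤ ε := by
  obtain ⟨t, ht, hf, hc⟩ := (isCompact_sphere (0 : F) 1).finite_cover_balls hε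
  obtain ⟨u, hu⟩ := exists_norm_eq F (zero_le_one' ℝ)
  have hnet : ∀ u, ‖u‖ = 1 → ∃ v ∈ hf.toFinset, ‖u - v‖ ≤ ε := by
    intro u hu
    have := hc (by simpa using hu : u ∈ Metric.sphere (0 : F) 1)
    simp only [Set.mem_iUnion, Metric.mem_ball, exists_prop] at this
    obtain ⟨v, hv, h⟩ := this
    exact ⟨v, by simpa using hv, by rw [← dist_eq_norm]; exact h.le⟩
  obtain ⟨v, hv, -⟩ := hnet u hu
  exact ⟨hf.toFinset, ⟨v, hv⟩, fun u hu => by simpa using ht (by simpa using hu), hnet⟩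

theorem norm_le_of_net {F G : Type*} [NormedAddCommGroup F] [InnerProductSpace ℝ F]
    [Nontrivial F] [NormedAddCommGroup G] [InnerProductSpace ℝ G]
    {ε : ℝ} {s : Finset F} {t : Finset G}
    (hs1 : ∀ u ∈ s, ‖u‖ = 1) (hs : ∀ u, ‖u‖ = 1 → ∃ v ∈ s, ‖u - v‖ ≤ ε)
    (hsn : s.Nonempty) (htn : t.Nonempty)
    (ht : ∀ u, ‖u‖ = 1 → ∃ v ∈ t, ‖u - v‖ ≤ ε) (M : G →L[ℝ] F) :
    ∃ i : s × t, (1 - 2 * ε) * ‖M‖ ≤ inner ℝ (i.1 : F) (M i.2) := by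
  have := hsn.to_subtype
  have := htn.to_subtype
  obtain ⟨i, hi⟩ := Finite.exists_max (fun i : s × t => inner ℝ (i.1 : F) (M i.2))
  refine ⟨i, ?_⟩
  set C := inner ℝ (i.1 : F) (M i.2)
  have hu : ∀ v : G, ‖v‖ = 1 → ‖M v‖ ≤ C + 2 * ε * ‖M‖ := by
    intro v hv
    obtain ⟨u, hu, hu'⟩ := exists_norm_eq_one_inner_eq_norm (M v)
    obtain ⟨u', hus, hue⟩ := hs u hu
    obtain ⟨v', hvs, hve⟩ := ht v hv
    have h1 := hi (⟨u', hus⟩, ⟨v', hvs⟩)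
    simp only at h1
    have e : inner ℝ u (M v) = inner ℝ u' (M v') + inner ℝ (u - u') (M v)
        + inner ℝ u' (M (v - v')) := by
      simp only [map_sub, inner_sub_left, inner_sub_right]; ring
    have h2 : inner ℝ (u - u') (M v) ≤ ε * ‖M‖ := by
      refine (real_inner_le_norm _ _).trans (mul_le_mul hue ?_ (norm_nonneg _)
        ((norm_nonneg _).trans hue))
      simpa [hv] using M.le_opNorm v
    have h3 : inner ℝ u' (M (v - v')) ≤ ε * ‖M‖ := by
      refine (real_inner_le_norm _ _).trans ?_
      rw [hs1 u' hus, one_mul, mul_comm]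
      exact (M.le_opNorm _).trans (mul_le_mul_of_nonneg_left hve (norm_nonneg _))
    rw [← hu', e]
    linarith
  have hC : 0 ≤ C + 2 * ε * ‖M‖ := by
    by_cases hG : Nontrivial G
    · obtain ⟨v, hv⟩ := exists_norm_eq G (zero_le_one' ℝ)
      exact (norm_nonneg _).trans (hu v hv)
    · rw [not_nontrivial_iff_subsingleton] at hG
      have h1 : M = 0 := by ext v; rw [Subsingleton.elim v 0]; simp
      simp [C, h1]
  have := M.opNorm_le_of_unit_norm hC hu
  linarith

end Chevet

section ChevetMatrix

open ProbabilityTheory Module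
open scoped Matrix.Norms.L2Operator

variable {ι κ l : Type*} [Fintype ι] [Fintype κ] [Fintype l]

/-- A matrix acting between Euclidean spaces. -/
noncomputable abbrev euclCLM [DecidableEq l] (A : Matrix κ l ℝ) :
    EuclideanSpace ℝ l →L[ℝ] EuclideanSpace ℝ κ :=
  LinearMap.toContinuousLinearMap (Matrix.toEuclideanLin A)

theorem norm_euclCLM [DecidableEq l] (A : Matrix κ l ℝ) : ‖euclCLM A‖ = ‖A‖ := rfl

theorem euclCLM_mul [DecidableEq l] [DecidableEq κ] (A : Matrix ι κ ℝ) (B : Matrix κ l ℝ)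
    (x : EuclideanSpace ℝ l) : euclCLM (A * B) x = euclCLM A (euclCLM B x) := by
  ext i
  simp [euclCLM, Matrix.mulVec_mulVec]

theorem inner_euclCLM [DecidableEq l] [DecidableEq κ] (A : Matrix κ l ℝ)
    (x : EuclideanSpace ℝ l) (y : EuclideanSpace ℝ κ) :
    inner ℝ (euclCLM A x) y = inner ℝ x (euclCLM Aᵀ y) := by
  simp only [PiLp.inner_apply, euclCLM, LinearMap.coe_toContinuousLinearMap',
    Matrix.toLpLin_apply, Matrix.mulVec, dotProduct, RCLike.inner_apply, conj_trivial,
    Finset.mul_sum, Finset.sum_mul, Matrix.transpose_apply]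
  rw [Finset.sum_comm]
  exact Finset.sum_congr rfl fun i _ => Finset.sum_congr rfl fun j _ => by ring

theorem norm_matrix_le_sqrt_sum [DecidableEq l] (A : Matrix κ l ℝ) :
    ‖A‖ ≤ √(∑ i, ∑ j, A i j ^ 2) := by
  rw [← norm_euclCLM]
  refine ContinuousLinearMap.opNorm_le_bound _ (Real.sqrt_nonneg _) fun x => ?_
  rw [EuclideanSpace.norm_eq, EuclideanSpace.norm_eq, ← Real.sqrt_mul (by positivity)]
  refine Real.sqrt_le_sqrt ?_
  rw [Finset.sum_mul]
  refine Finset.sum_le_sum fun i _ => ?_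
  simpa [Matrix.mulVec, dotProduct] using
    Finset.sum_mul_sq_le_sq_mul_sq Finset.univ (fun j => A i j) (fun j => x j)

/-- The Gaussian process comparing `⟪u, G w⟫` with `‖T‖ ⟪u, h⟫ + ⟪w, g⟫`. -/
noncomputable def chevetLeft (u : EuclideanSpace ℝ ι) (w : EuclideanSpace ℝ κ) :
    EuclideanSpace ℝ ((ι × κ) ⊕ (ι ⊕ κ)) :=
  WithLp.toLp 2 (Sum.elim (fun p => u p.1 * w p.2) 0)

noncomputable def chevetRight (s : ℝ) (u : EuclideanSpace ℝ ι) (w : EuclideanSpace ℝ κ) :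
    EuclideanSpace ℝ ((ι × κ) ⊕ (ι ⊕ κ)) :=
  WithLp.toLp 2 (Sum.elim 0 (Sum.elim (fun i => s * u i) w))

theorem inner_chevetLeft_self (u u' : EuclideanSpace ℝ ι) (w w' : EuclideanSpace ℝ κ) :
    inner ℝ (chevetLeft u w) (chevetLeft u' w') = inner ℝ u u' * inner ℝ w w' := by
  simp only [chevetLeft, PiLp.inner_apply, Fintype.sum_sum_type, Sum.elim_inl, Sum.elim_inr,
    Pi.zero_apply, RCLike.inner_apply, conj_trivial, Fintype.sum_prod_type, mul_zero,
    Finset.sum_const_zero, add_zero, Finset.sum_mul_sum]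
  exact Finset.sum_congr rfl fun i _ => Finset.sum_congr rfl fun j _ => by ring

theorem inner_chevetRight_self (s : ℝ) (u u' : EuclideanSpace ℝ ι) (w w' : EuclideanSpace ℝ κ) :
    inner ℝ (chevetRight s u w) (chevetRight s u' w') = s ^ 2 * inner ℝ u u' + inner ℝ w w' := by
  simp only [chevetRight, PiLp.inner_apply, Fintype.sum_sum_type, Sum.elim_inl, Sum.elim_inr,
    Pi.zero_apply, RCLike.inner_apply, conj_trivial, mul_zero,
    Finset.sum_const_zero, zero_add, Finset.mul_sum]
  congr 1
  exact Finset.sum_congr rfl fun i _ => by ring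

theorem inner_chevetLeft_chevetRight (s : ℝ) (u u' : EuclideanSpace ℝ ι)
    (w w' : EuclideanSpace ℝ κ) : inner ℝ (chevetLeft u w) (chevetRight s u' w') = 0 := by
  simp [chevetLeft, chevetRight, PiLp.inner_apply]

theorem norm_chevetLeft_sub_le {s : ℝ} {u u' : EuclideanSpace ℝ ι} {w w' : EuclideanSpace ℝ κ}
    (hu : ‖u‖ = 1) (hu' : ‖u'‖ = 1) (hw : ‖w‖ ≤ s) (hw' : ‖w'‖ ≤ s) :
    ‖chevetLeft u w - chevetLeft u' w'‖ ≤ ‖chevetRight s u w - chevetRight s u' w'‖ := by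
  rw [← sq_le_sq₀ (norm_nonneg _) (norm_nonneg _), norm_sub_sq_real, norm_sub_sq_real]
  simp only [← real_inner_self_eq_norm_sq, inner_chevetLeft_self, inner_chevetRight_self]
  simp only [real_inner_self_eq_norm_sq, hu, hu']
  have hc : inner ℝ u u' ≤ 1 := by simpa [hu, hu'] using real_inner_le_norm u u'
  have hd : inner ℝ w w' ≤ s ^ 2 := (real_inner_le_norm w w').trans <| by
    rw [sq]; exact mul_le_mul hw hw' (norm_nonneg _) ((norm_nonneg _).trans hw)
  nlinarith [mul_nonneg (sub_nonneg.2 hc) (sub_nonneg.2 hd)]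

/-- Chevet's inequality for a standard Gaussian matrix multiplied by a fixed matrix. -/
theorem integral_norm_gaussianMat_mul_le [DecidableEq l] [Nonempty ι] [Nonempty l]
    (T : Matrix κ l ℝ) :
    Integrable (fun G : ι → κ → ℝ => ‖Matrix.of G * T‖) (gaussianMat ι κ) ∧
    ∫ G : ι → κ → ℝ, ‖Matrix.of G * T‖ ∂(gaussianMat ι κ) ≤
      √(Fintype.card ι) * ‖T‖ + √(∑ i, ∑ j, T i j ^ 2) := by
  classical
  let e : (ι × κ) ⊕ (ι ⊕ κ) → EuclideanSpace ℝ ((ι × κ) ⊕ (ι ⊕ κ)) := fun i =>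
      EuclideanSpace.single i 1
  have he : Orthonormal ℝ e := EuclideanSpace.orthonormal_single
  have hinner : ∀ i (x : EuclideanSpace ℝ ((ι × κ) ⊕ (ι ⊕ κ))),
      inner ℝ (e i) x = x i := fun i x => by
    simp [e, EuclideanSpace.inner_single_left]
  have hmap : (stdGaussian (EuclideanSpace ℝ ((ι × κ) ⊕ (ι ⊕ κ)))).map
      (fun x i k => x (Sum.inl (i, k))) = gaussianMat ι κ := by
    rw [← map_inner_stdGaussian_mat (he.comp _ Sum.inl_injective)]
    simp [hinner]
  have hcont : Continuous (fun G : ι → κ → ℝ => ‖Matrix.of G * T‖) := by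
    have : Continuous (fun G : ι → κ → ℝ => Matrix.of G) := continuous_id
    fun_prop
  have hmeas : Measurable (fun (x : EuclideanSpace ℝ ((ι × κ) ⊕ (ι ⊕ κ))) (i : ι) (k : κ) =>
      x (Sum.inl (i, k))) := by fun_prop
  rw [← hmap, integrable_map_measure hcont.aestronglyMeasurable hmeas.aemeasurable,
    integral_map hmeas.aemeasurable hcont.aestronglyMeasurable]
  let Gm : EuclideanSpace ℝ ((ι × κ) ⊕ (ι ⊕ κ)) → Matrix ι κ ℝ := fun x => Matrix.of fun i k =>
      x (Sum.inl (i, k))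
  change Integrable (fun x => ‖Gm x * T‖) (stdGaussian (EuclideanSpace ℝ ((ι × κ) ⊕ (ι ⊕ κ)))) ∧
    ∫ x, ‖Gm x * T‖ ∂(stdGaussian (EuclideanSpace ℝ ((ι × κ) ⊕ (ι ⊕ κ)))) ≤ _
  have hcont' : Continuous fun x => ‖Gm x * T‖ := by
    refine hcont.comp (f := fun (x : EuclideanSpace ℝ ((ι × κ) ⊕ (ι ⊕ κ))) (i : ι) (k : κ) =>
        x (Sum.inl (i, k))) ?_
    fun_prop
  have hI : Integrable (fun x => ‖Gm x * T‖)
      (stdGaussian (EuclideanSpace ℝ ((ι × κ) ⊕ (ι ⊕ κ)))) := by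
    refine ((integrable_norm_stdGaussian
        (E := EuclideanSpace ℝ ((ι × κ) ⊕ (ι ⊕ κ)))).mul_const ‖T‖).mono'
      hcont'.aestronglyMeasurable (ae_of_all _ fun x => ?_)
    rw [norm_norm]
    refine (l2_opNorm_mul _ _).trans (mul_le_mul_of_nonneg_right ?_ (norm_nonneg _))
    refine (norm_matrix_le_sqrt_sum _).trans ?_
    rw [EuclideanSpace.norm_eq]
    refine Real.sqrt_le_sqrt ?_
    simp only [Gm, Matrix.of_apply, Real.norm_eq_abs, sq_abs, Fintype.sum_sum_type,
      Fintype.sum_prod_type]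
    have : (0 : ℝ) ≤ ∑ i, x (Sum.inr (Sum.inl i)) ^ 2 + ∑ i, x (Sum.inr (Sum.inr i)) ^ 2 := by
      positivity
    linarith
  refine ⟨hI, ?_⟩
  have hh := integral_sqrt_sum_inner_sq_le (fun i : ι => e (Sum.inr (Sum.inl i)))
  let y : l → EuclideanSpace ℝ ((ι × κ) ⊕ (ι ⊕ κ)) := fun j =>
      chevetRight 0 0 (WithLp.toLp 2 fun k => T k j)
  have hg := integral_sqrt_sum_inner_sq_le y
  set H : EuclideanSpace ℝ ((ι × κ) ⊕ (ι ⊕ κ)) → ℝ := fun x =>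
      √(∑ i : ι, inner ℝ (e (Sum.inr (Sum.inl i))) x ^ 2)
  set K : EuclideanSpace ℝ ((ι × κ) ⊕ (ι ⊕ κ)) → ℝ := fun x => √(∑ j, inner ℝ (y j) x ^ 2)
  have hgint : Integrable (fun x => ‖T‖ * H x + K x)
      (stdGaussian (EuclideanSpace ℝ ((ι × κ) ⊕ (ι ⊕ κ)))) :=
    (hh.1.const_mul _).add hg.1
  have hbound : ∫ x, (‖T‖ * H x + K x) ∂(stdGaussian (EuclideanSpace ℝ ((ι × κ) ⊕ (ι ⊕ κ)))) ≤
      √(Fintype.card ι) * ‖T‖ + √(∑ i, ∑ j, T i j ^ 2) := by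
    rw [integral_add (hh.1.const_mul _) hg.1, integral_const_mul]
    have h1 := hh.2
    have h2 := hg.2
    have e1 : ∑ i : ι, ‖e (Sum.inr (Sum.inl i))‖ ^ 2 = Fintype.card ι := by
      simp [e]
    have e2 : ∑ j, ‖y j‖ ^ 2 = ∑ i, ∑ j, T i j ^ 2 := by
      rw [Finset.sum_comm]
      refine Finset.sum_congr rfl fun j _ => ?_
      rw [← real_inner_self_eq_norm_sq, inner_chevetRight_self, real_inner_self_eq_norm_sq]
      simp [EuclideanSpace.real_norm_sq_eq]
    rw [e1] at h1
    rw [e2] at h2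
    have := mul_le_mul_of_nonneg_left h1 (norm_nonneg T)
    linarith
  refine le_trans ?_ hbound
  have hε : ∀ ε : ℝ, 0 < ε → (1 - 2 * ε) * ∫ x,
      ‖Gm x * T‖ ∂(stdGaussian (EuclideanSpace ℝ ((ι × κ) ⊕ (ι ⊕ κ)))) ≤
      ∫ x, (‖T‖ * H x + K x) ∂(stdGaussian (EuclideanSpace ℝ ((ι × κ) ⊕ (ι ⊕ κ)))) := by
    intro ε hε
    obtain ⟨s, hs, hs1, hsn⟩ := exists_finite_net_sphere (EuclideanSpace ℝ ι) hε
    obtain ⟨t, ht, ht1, htn⟩ := exists_finite_net_sphere (EuclideanSpace ℝ l) hε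
    have := hs.to_subtype
    have := ht.to_subtype
    have hTn : ∀ v : EuclideanSpace ℝ l, ‖v‖ = 1 → ‖euclCLM T v‖ ≤ ‖T‖ := fun v hv => by
      simpa [hv, norm_euclCLM] using (euclCLM T).le_opNorm v
    rw [← integral_const_mul]
    refine integral_le_of_sudakovFernique
      (fun i : s × t => chevetLeft (i.1 : EuclideanSpace ℝ ι) (euclCLM T i.2))
      (fun i : s × t => chevetRight ‖T‖ (i.1 : EuclideanSpace ℝ ι) (euclCLM T i.2))
      (fun i j => inner_chevetLeft_chevetRight _ _ _ _ _)
      (fun i j => norm_chevetLeft_sub_le (hs1 _ i.1.2) (hs1 _ j.1.2) (hTn _ (ht1 _ i.2.2))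
        (hTn _ (ht1 _ j.2.2))) (hI.const_mul _) hgint ?_ ?_
    · intro x
      obtain ⟨i, hi⟩ := norm_le_of_net hs1 hsn hs ht htn (euclCLM (Gm x * T))
      refine ⟨i, (hi.trans_eq ?_)⟩
      rw [euclCLM_mul]
      simp only [chevetLeft, PiLp.inner_apply, Fintype.sum_sum_type, Sum.elim_inl, Sum.elim_inr,
        Pi.zero_apply, RCLike.inner_apply, conj_trivial, Fintype.sum_prod_type, mul_zero,
        Finset.sum_const_zero, add_zero, Gm]
      refine Finset.sum_congr rfl fun a _ => ?_
      conv_lhs => simp only [euclCLM, LinearMap.coe_toContinuousLinearMap', Matrix.toLpLin_apply,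
        Matrix.mulVec, dotProduct, Matrix.of_apply, Finset.sum_mul]
      refine Finset.sum_congr rfl fun b _ => ?_
      simp only [euclCLM, LinearMap.coe_toContinuousLinearMap', Matrix.toLpLin_apply,
        Matrix.mulVec, dotProduct]
      ring
    · intro x i
      let h : EuclideanSpace ℝ ι := WithLp.toLp 2 fun a => x (Sum.inr (Sum.inl a))
      let g : EuclideanSpace ℝ κ := WithLp.toLp 2 fun a => x (Sum.inr (Sum.inr a))
      have e0 : inner ℝ (chevetRight ‖T‖ (i.1 : EuclideanSpace ℝ ι) (euclCLM T i.2)) x =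
          ‖T‖ * inner ℝ (i.1 : EuclideanSpace ℝ ι) h + inner ℝ (euclCLM T i.2) g := by
        simp only [chevetRight, PiLp.inner_apply, Fintype.sum_sum_type, Sum.elim_inl,
          Sum.elim_inr, Pi.zero_apply, RCLike.inner_apply, conj_trivial, mul_zero,
          Finset.sum_const_zero, zero_add, Finset.mul_sum, h, g]
        congr 1
        exact Finset.sum_congr rfl fun i _ => by ring
      have hH : H x = ‖h‖ := by
        simp [H, h, hinner, EuclideanSpace.norm_eq]
      have hK : K x = ‖euclCLM Tᵀ g‖ := by
        simp only [K, EuclideanSpace.norm_eq]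
        congr 1
        refine Finset.sum_congr rfl fun j _ => ?_
        simp [y, chevetRight, PiLp.inner_apply, euclCLM, Matrix.mulVec, dotProduct, g, mul_comm]
      rw [e0, inner_euclCLM, hH, hK]
      have h1 := real_inner_le_norm (i.1 : EuclideanSpace ℝ ι) h
      have h2 := real_inner_le_norm (i.2 : EuclideanSpace ℝ l) (euclCLM Tᵀ g)
      rw [hs1 _ i.1.2, one_mul] at h1
      rw [ht1 _ i.2.2, one_mul] at h2
      have := mul_le_mul_of_nonneg_left h1 (norm_nonneg T)
      linarith
  have ht : Filter.Tendsto (fun ε : ℝ => (1 - 2 * ε) * ∫ x,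
      ‖Gm x * T‖ ∂(stdGaussian (EuclideanSpace ℝ ((ι × κ) ⊕ (ι ⊕ κ)))))
      (nhdsWithin 0 (Set.Ioi 0)) (nhds ((1 - 2 * 0) * ∫ x,
          ‖Gm x * T‖ ∂(stdGaussian (EuclideanSpace ℝ ((ι × κ) ⊕ (ι ⊕ κ)))))) := by
    refine Filter.Tendsto.mono_left ?_ nhdsWithin_le_nhds
    exact Continuous.tendsto (by fun_prop) 0
  rw [mul_zero, sub_zero, one_mul] at ht
  exact le_of_tendsto ht (Filter.eventually_of_mem self_mem_nhdsWithin hε)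

end ChevetMatrix

section GaussianPinv

open ProbabilityTheory Module
open scoped Matrix.Norms.L2Operator

variable {ι κ l : Type*} [Fintype ι] [Fintype κ] [Fintype l] [DecidableEq ι]

/-- The right inverse `Gᵀ (G Gᵀ)⁻¹` of a matrix of full row rank. -/
noncomputable def rightInv (G : Matrix ι κ ℝ) : Matrix κ ι ℝ := Gᵀ * (G * Gᵀ)⁻¹

theorem mul_rightInv {G : Matrix ι κ ℝ} (hG : (G * Gᵀ).det ≠ 0) : G * rightInv G = 1 := by
  rw [rightInv, ← Matrix.mul_assoc, Matrix.mul_nonsing_inv _ (isUnit_iff_ne_zero.2 hG)]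

theorem rightInv_of_det_eq_zero {G : Matrix ι κ ℝ} (hG : (G * Gᵀ).det = 0) : rightInv G = 0 := by
  rw [rightInv, Matrix.nonsing_inv_apply_not_isUnit _ (by simp [hG]), Matrix.mul_zero]

theorem measurable_rightInv (i : κ) (j : ι) :
    Measurable fun G : ι → κ → ℝ => rightInv (Matrix.of G) i j := by
  have h1 : Continuous fun G : ι → κ → ℝ => Matrix.of G := continuous_id
  have h2 : ∀ i j, Measurable fun G : ι → κ → ℝ => (Matrix.of G * (Matrix.of G)ᵀ)⁻¹ i j := by
    intro i j
    simp only [Matrix.inv_def, Ring.inverse_eq_inv', Matrix.smul_apply, smul_eq_mul]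
    refine Measurable.mul ?_ ?_
    · refine Measurable.inv (Continuous.measurable ?_)
      fun_prop
    · exact Continuous.measurable (Continuous.matrix_elem (by fun_prop) i j)
  simp only [rightInv, Matrix.mul_apply]
  refine Finset.measurable_sum _ fun x _ => Measurable.mul ?_ (h2 x j)
  exact Continuous.measurable (Continuous.matrix_elem (by fun_prop) i x)

theorem measurable_euclCLM_apply {Ω : Type*} [MeasurableSpace Ω] {M : Ω → Matrix κ ι ℝ}
    (hM : ∀ i j, Measurable fun ω => M ω i j) (x : EuclideanSpace ℝ ι) :
    Measurable fun ω => euclCLM (M ω) x := by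
  have : (fun ω => euclCLM (M ω) x) = fun ω => WithLp.toLp 2 fun i => ∑ j, M ω i j * x j := rfl
  rw [this]
  exact (WithLp.measurable_toLp 2 _).comp (measurable_pi_iff.2 fun i =>
    Finset.measurable_sum _ fun j _ => (hM i j).mul_const _)

theorem measurable_norm_matrix {Ω : Type*} [MeasurableSpace Ω] {M : Ω → Matrix κ ι ℝ}
    (hM : ∀ i j, Measurable fun ω => M ω i j) : Measurable fun ω => ‖M ω‖ := by
  have hc : Continuous fun G : κ → ι → ℝ => ‖Matrix.of G‖ := by
    have h1 : Continuous fun G : κ → ι → ℝ => Matrix.of G := continuous_id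
    fun_prop
  exact hc.measurable.comp (measurable_pi_iff.2 fun i => measurable_pi_iff.2 fun j => hM i j)

/-- `rightInv G y` is the solution of minimal norm of the equation `G x = y`. -/
theorem norm_rightInv_le [DecidableEq κ] (G : Matrix ι κ ℝ) {x : EuclideanSpace ℝ κ}
    {y : EuclideanSpace ℝ ι}
    (h : euclCLM G x = y) : ‖euclCLM (rightInv G) y‖ ≤ ‖x‖ := by
  by_cases hG : (G * Gᵀ).det = 0
  · simp [rightInv_of_det_eq_zero hG]
  set t := euclCLM (rightInv G) y with ht
  have e1 : t = euclCLM Gᵀ (euclCLM (G * Gᵀ)⁻¹ y) := by rw [ht, rightInv, euclCLM_mul]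
  have e2 : euclCLM G t = y := by
    rw [ht, ← euclCLM_mul, mul_rightInv hG]; ext i; simp
  have e3 : inner ℝ t t = inner ℝ t x := by
    have e4 : ∀ z, inner ℝ t z = inner ℝ (euclCLM (G * Gᵀ)⁻¹ y) (euclCLM G z) := fun z => by
      rw [e1, inner_euclCLM, transpose_transpose]
    rw [e4, e4, e2, h]
  have h4 := real_inner_le_norm t x
  rw [← e3, real_inner_self_eq_norm_sq] at h4
  rcases (norm_nonneg t).eq_or_lt with h0 | h0
  · rw [← h0]; exact norm_nonneg _
  · nlinarith

theorem exists_orthonormal_orthogonal {F : Type*} [NormedAddCommGroup F] [InnerProductSpace ℝ F]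
    [FiniteDimensional ℝ F] (g : l → F) {d : ℕ} (hd : Fintype.card l + d ≤ finrank ℝ F) :
    ∃ e : Fin d → F, Orthonormal ℝ e ∧ ∀ i j, inner ℝ (g i) (e j) = 0 := by
  set W := Submodule.span ℝ (Set.range g)
  have h1 : finrank ℝ W ≤ Fintype.card l := finrank_range_le_card g
  have h2 := W.finrank_add_finrank_orthogonal
  have h3 : d ≤ finrank ℝ Wᗮ := by omega
  let b := stdOrthonormalBasis ℝ Wᗮ
  refine ⟨fun j => (b (Fin.castLE h3 j) : F), ?_, fun i j => ?_⟩
  · exact (b.orthonormal.comp _ (Fin.castLE_injective h3)).comp_linearIsometry Wᗮ.subtypeₗᵢ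
  · exact Submodule.inner_right_of_mem_orthogonal
      (Submodule.subset_span (Set.mem_range_self i)) (b (Fin.castLE h3 j)).2

theorem map_inner_gaussianVec {ι : Type*} [Fintype ι] {e : ι → EuclideanSpace ℝ κ}
    (he : Orthonormal ℝ e) :
    (gaussianVec κ).map (fun g => WithLp.toLp 2 fun i => inner ℝ (e i) (WithLp.toLp 2 g)) =
      stdGaussian (EuclideanSpace ℝ ι) := by
  have h := map_pi_eq_stdGaussian (ι := κ)
  have h' := map_pi_eq_stdGaussian (ι := ι)
  have h2 := map_inner_stdGaussian he
  rw [gaussianVec] at h2 ⊢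
  rw [← h', ← h2, ← h, Measure.map_map (by fun_prop) (by fun_prop),
    Measure.map_map (by fun_prop) (by fun_prop)]
  rfl

theorem ae_ne_zero_stdGaussian {E : Type*} [NormedAddCommGroup E] [InnerProductSpace ℝ E]
    [FiniteDimensional ℝ E] [MeasurableSpace E] [BorelSpace E] [Nontrivial E] :
    ∀ᵐ x ∂(stdGaussian E), x ≠ 0 := by
  rw [stdGaussian_eq_withDensity]
  refine (withDensity_absolutelyContinuous _ _) ?_
  simp

/-- Integrating out a single row of a Gaussian matrix. -/
theorem lintegral_gaussianMat_le {f : (ι → κ → ℝ) → ENNReal} (hf : Measurable f) (j : ι)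
    {C : ENNReal} (h : ∀ G, ∫⁻ g, f (Function.update G j g) ∂(gaussianVec κ) ≤ C) :
    ∫⁻ G, f G ∂(gaussianMat ι κ) ≤ C := by
  rw [gaussianMat, lintegral_eq_lmarginal_univ (fun _ _ => 0),
    lmarginal_erase' _ hf (Finset.mem_univ j)]
  refine (lmarginal_mono (g := fun _ => C) (fun G => h G) _).trans ?_
  simp [lmarginal]

theorem lintegral_rightInv_single_rpow_le (j : ι) {p : ℕ}
    (hp : Fintype.card κ = Fintype.card ι + p) {a : ℝ} (ha0 : 0 < a) (ha : a < p + 1) :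
    ∫⁻ G : ι → κ → ℝ, ENNReal.ofReal
        (‖euclCLM (rightInv (Matrix.of G)) (EuclideanSpace.single j 1)‖ ^ a) ∂(gaussianMat ι κ) ≤
      ENNReal.ofReal (2 ^ (-a / 2) * Real.Gamma ((p + 1 - a) / 2) / Real.Gamma ((p + 1) / 2)) := by
  classical
  have hmeas : Measurable fun G : ι → κ → ℝ => ENNReal.ofReal
        (‖euclCLM (rightInv (Matrix.of G)) (EuclideanSpace.single j 1)‖ ^ a) := by
    refine ENNReal.measurable_ofReal.comp ((Measurable.pow_const · a) ?_)
    exact (measurable_euclCLM_apply measurable_rightInv _).norm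
  refine lintegral_gaussianMat_le hmeas j fun G => ?_
  obtain ⟨e, he, hge⟩ := exists_orthonormal_orthogonal
    (fun i : {i // i ≠ j} => (WithLp.toLp 2 (G i) : EuclideanSpace ℝ κ)) (d := p + 1) (by
      have : 0 < Fintype.card ι := Fintype.card_pos_iff.2 ⟨j⟩
      simp only [finrank_euclideanSpace, hp, ne_eq, Fintype.card_subtype_compl,
        Fintype.card_unique]
      omega)
  have hmap := map_inner_gaussianVec he
  set c : (κ → ℝ) → EuclideanSpace ℝ (Fin (p + 1)) := fun g =>
    WithLp.toLp 2 fun i => inner ℝ (e i) (WithLp.toLp 2 g) with hc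
  have hcm : Measurable c := by fun_prop
  have hpt : ∀ g, c g ≠ 0 → ‖euclCLM (rightInv (Matrix.of (Function.update G j g)))
      (EuclideanSpace.single j 1)‖ ≤ ‖c g‖⁻¹ := by
    intro g hg
    have hg' : ‖c g‖ ≠ 0 := norm_ne_zero_iff.2 hg
    set x : EuclideanSpace ℝ κ := ∑ i, c g i • e i
    have hxn : ‖x‖ = ‖c g‖ := by
      rw [← sq_eq_sq₀ (norm_nonneg _) (norm_nonneg _), ← real_inner_self_eq_norm_sq,
        he.inner_sum, EuclideanSpace.real_norm_sq_eq]
      simp [sq]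
    have hx : euclCLM (Matrix.of (Function.update G j g)) x =
        ‖c g‖ ^ 2 • EuclideanSpace.single j 1 := by
      have hrow : ∀ i, euclCLM (Matrix.of (Function.update G j g)) x i =
          inner ℝ (WithLp.toLp 2 (Function.update G j g i)) x := by
        intro i
        simp [Matrix.mulVec, dotProduct, PiLp.inner_apply, mul_comm]
      ext i
      rw [hrow]
      by_cases hij : i = j
      · subst hij
        simp only [Function.update_self, x, inner_sum, inner_smul_right]
        rw [EuclideanSpace.real_norm_sq_eq]
        simp [hc, sq, real_inner_comm]
      · simp only [ne_eq, hij, not_false_eq_true, Function.update_of_ne, x, inner_sum,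
          inner_smul_right]
        have := fun m => hge ⟨i, hij⟩ m
        simp only at this
        simp [this, hij]
    have := norm_rightInv_le (Matrix.of (Function.update G j g)) (x := (‖c g‖ ^ 2)⁻¹ • x)
      (y := EuclideanSpace.single j 1) (by rw [map_smul, hx, smul_smul]; simp [hg])
    refine this.trans_eq ?_
    rw [norm_smul, hxn]
    simp
    field_simp
  have hae : ∀ᵐ g ∂(gaussianVec κ), c g ≠ 0 := by
    have := ae_ne_zero_stdGaussian (E := EuclideanSpace ℝ (Fin (p + 1)))
    rw [← hmap] at this
    exact ae_of_ae_map hcm.aemeasurable this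
  calc _ ≤ ∫⁻ g, ENNReal.ofReal (‖c g‖ ^ (-a)) ∂(gaussianVec κ) := by
        refine lintegral_mono_ae (hae.mono fun g hg => ?_)
        refine ENNReal.ofReal_le_ofReal ?_
        rw [Real.rpow_neg (norm_nonneg _), ← Real.inv_rpow (norm_nonneg _)]
        exact Real.rpow_le_rpow (norm_nonneg _) (hpt g hg) ha0.le
    _ = ∫⁻ x, ENNReal.ofReal (‖x‖ ^ (-a)) ∂(stdGaussian (EuclideanSpace ℝ (Fin (p + 1)))) := by
        rw [← hmap, lintegral_map (by fun_prop) hcm]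
    _ = _ := by
        rw [lintegral_norm_rpow_stdGaussian (by simp; linarith)]
        simp [sub_eq_add_neg]

end GaussianPinv

section GaussianPinvNorm

open ProbabilityTheory Module
open scoped Matrix.Norms.L2Operator

variable {ι κ : Type*} [Fintype ι] [Fintype κ] [DecidableEq ι]

theorem lintegral_rightInv_sum_sq_le {p : ℕ}
    (hp : Fintype.card κ = Fintype.card ι + p) (hp2 : 2 ≤ p) :
    ∫⁻ G : ι → κ → ℝ, ENNReal.ofReal (∑ i, ∑ j, rightInv (Matrix.of G) i j ^ 2)
        ∂(gaussianMat ι κ) ≤ ENNReal.ofReal (Fintype.card ι / ((p : ℝ) - 1)) := by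
  have hp' : (2 : ℝ) ≤ p := by exact_mod_cast hp2
  have e1 : ∀ M : Matrix κ ι ℝ, ENNReal.ofReal (∑ i, ∑ j, M i j ^ 2) =
      ∑ j, ENNReal.ofReal (‖euclCLM M (EuclideanSpace.single j 1)‖ ^ (2 : ℝ)) := by
    intro M
    rw [← ENNReal.ofReal_sum_of_nonneg fun _ _ => by positivity, Finset.sum_comm]
    congr 1
    refine Finset.sum_congr rfl fun j _ => ?_
    rw [Real.rpow_two, EuclideanSpace.real_norm_sq_eq]
    simp
  have e2 : (2 : ℝ) ^ (-(2 : ℝ) / 2) * Real.Gamma ((p + 1 - 2) / 2) / Real.Gamma ((p + 1) / 2) =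
      1 / ((p : ℝ) - 1) := by
    have h : ((p : ℝ) + 1) / 2 = (p + 1 - 2) / 2 + 1 := by ring
    have hpos : 0 < Real.Gamma (((p : ℝ) + 1 - 2) / 2) := Real.Gamma_pos_of_pos (by linarith)
    rw [h, Real.Gamma_add_one (by linarith), show -(2 : ℝ) / 2 = -1 by norm_num, Real.rpow_neg_one]
    have : (p : ℝ) - 1 ≠ 0 := by linarith
    have : (p : ℝ) + 1 - 2 ≠ 0 := by linarith
    field_simp
    ring
  simp_rw [e1]
  rw [lintegral_finsetSum' _ fun j _ => ?_]
  · refine (Finset.sum_le_sum fun j _ => lintegral_rightInv_single_rpow_le j hp (a := 2)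
      (by norm_num) (by linarith)).trans ?_
    rw [e2, Finset.sum_const, nsmul_eq_mul, Finset.card_univ, ← ENNReal.ofReal_natCast,
      ← ENNReal.ofReal_mul (by positivity)]
    refine ENNReal.ofReal_le_ofReal (le_of_eq (by ring))
  · exact (ENNReal.measurable_ofReal.comp
      ((measurable_euclCLM_apply measurable_rightInv _).norm.pow_const _)).aemeasurable

/-- A matrix with orthonormal rows maps Gaussian matrices to Gaussian matrices. -/
theorem map_mul_gaussianMat {ι' : Type*} [Fintype ι'] [DecidableEq ι'] {O : Matrix ι' ι ℝ}
    (hO : O * Oᵀ = 1) :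
    (gaussianMat ι κ).map (fun G i k => (O * Matrix.of G) i k) = gaussianMat ι' κ := by
  classical
  have he := EuclideanSpace.orthonormal_single (𝕜 := ℝ) (ι := ι × κ)
  have h1 := map_inner_stdGaussian_mat he
  let e : ι' × κ → EuclideanSpace ℝ (ι × κ) := fun q =>
    WithLp.toLp 2 fun q' => O q.1 q'.1 * (1 : Matrix κ κ ℝ) q.2 q'.2
  have he' : Orthonormal ℝ e := by
    rw [orthonormal_iff_ite]
    rintro ⟨i, k⟩ ⟨i', k'⟩
    have h2 : (O * Oᵀ) i i' * ((1 : Matrix κ κ ℝ) * (1 : Matrix κ κ ℝ)ᵀ) k k' =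
        inner ℝ (e (i, k)) (e (i', k')) := by
      simp only [PiLp.inner_apply, e, Matrix.mul_apply, Finset.sum_mul_sum, Fintype.sum_prod_type,
        RCLike.inner_apply, conj_trivial, Matrix.transpose_apply]
      exact Finset.sum_congr rfl fun a _ => Finset.sum_congr rfl fun b _ => by ring
    rw [← h2, hO]
    simp only [transpose_one, mul_one, Matrix.one_apply, Prod.mk.injEq, ite_and, mul_ite,
      mul_zero]
    split_ifs <;> rfl
  have h2 := map_inner_stdGaussian_mat he'
  have hm : Measurable (fun (G : ι → κ → ℝ) (i : ι') (k : κ) => (O * Matrix.of G) i k) := by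
    refine measurable_pi_iff.2 fun i => measurable_pi_iff.2 fun j => ?_
    simp only [Matrix.mul_apply, Matrix.of_apply]
    fun_prop
  rw [← h1, ← h2, Measure.map_map hm (by fun_prop)]
  congr 1
  funext x i k
  simp [e, Matrix.mul_apply, PiLp.inner_apply, Fintype.sum_prod_type, Matrix.one_apply, mul_comm]

theorem exists_orthogonal_transpose_apply (j : ι) (z : EuclideanSpace ℝ ι) :
    ∃ O : Matrix ι ι ℝ, O * Oᵀ = 1 ∧ euclCLM Oᵀ z = EuclideanSpace.single j ‖z‖ := by
  by_cases hz : z = 0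
  · exact ⟨1, by simp, by ext i; simp [hz]⟩
  have hz' : ‖z‖ ≠ 0 := norm_ne_zero_iff.2 hz
  obtain ⟨b, hb⟩ := Orthonormal.exists_orthonormalBasis_extension_of_card_eq (𝕜 := ℝ) (ι := ι)
    (E := EuclideanSpace ℝ ι) (by simp) (v := fun _ => ‖z‖⁻¹ • z) (s := {j}) (by
      rw [orthonormal_iff_ite]
      rintro ⟨i, hi⟩ ⟨i', hi'⟩
      obtain rfl : i = j := hi
      obtain rfl : i' = i := hi'
      simp only [Set.domRestrict_apply, if_true, real_inner_smul_left, inner_smul_right,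
        real_inner_self_eq_norm_sq]
      field_simp)
  have hbz := hb j rfl
  let O : Matrix ι ι ℝ := Matrix.of fun i a => b a i
  have hO : Oᵀ * O = 1 := by
    ext a a'
    have := orthonormal_iff_ite.1 b.orthonormal a a'
    rw [Matrix.one_apply, ← this]
    simp [O, Matrix.mul_apply, PiLp.inner_apply, mul_comm]
  refine ⟨O, mul_eq_one_comm.1 hO, ?_⟩
  ext a
  have h1 : euclCLM Oᵀ z a = inner ℝ (b a) z := by
    simp [O, Matrix.mulVec, dotProduct, PiLp.inner_apply, mul_comm]
  have hz2 : z = ‖z‖ • b j := by rw [hbz, smul_smul]; simp [hz']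
  rw [h1]
  nth_rewrite 1 [hz2]
  rw [inner_smul_right, orthonormal_iff_ite.1 b.orthonormal]
  simp

theorem rightInv_mul_of_orthogonal {O : Matrix ι ι ℝ} (hO : O * Oᵀ = 1) (G : Matrix ι κ ℝ) :
    rightInv (O * G) = rightInv G * Oᵀ := by
  have hO' : Oᵀ * O = 1 := mul_eq_one_comm.1 hO
  have h1 : O⁻¹ = Oᵀ := Matrix.inv_eq_right_inv hO
  have h2 : (Oᵀ)⁻¹ = O := Matrix.inv_eq_right_inv hO'
  rw [rightInv, rightInv, Matrix.transpose_mul,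
    show O * G * (Gᵀ * Oᵀ) = O * ((G * Gᵀ) * Oᵀ) by simp only [Matrix.mul_assoc],
    Matrix.mul_inv_rev, Matrix.mul_inv_rev, h1, h2]
  simp only [← Matrix.mul_assoc]
  rw [Matrix.mul_assoc Gᵀ Oᵀ O, hO', Matrix.mul_one]

theorem lintegral_rightInv_rpow (j : ι) (a : ℝ) (z : EuclideanSpace ℝ ι) :
    ∫⁻ G : ι → κ → ℝ, ENNReal.ofReal (‖euclCLM (rightInv (Matrix.of G)) z‖ ^ a)
        ∂(gaussianMat ι κ) =
    ENNReal.ofReal (‖z‖ ^ a) * ∫⁻ G : ι → κ → ℝ, ENNReal.ofReal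
        (‖euclCLM (rightInv (Matrix.of G)) (EuclideanSpace.single j 1)‖ ^ a)
          ∂(gaussianMat ι κ) := by
  obtain ⟨O, hO, hz⟩ := exists_orthogonal_transpose_apply j z
  have hmeas : ∀ x : EuclideanSpace ℝ ι, Measurable fun G : ι → κ → ℝ => ENNReal.ofReal
      (‖euclCLM (rightInv (Matrix.of G)) x‖ ^ a) := fun x => ENNReal.measurable_ofReal.comp
      ((measurable_euclCLM_apply measurable_rightInv _).norm.pow_const _)
  have hm : Measurable (fun (G : ι → κ → ℝ) (i : ι) (k : κ) => (O * Matrix.of G) i k) := by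
    refine measurable_pi_iff.2 fun i => measurable_pi_iff.2 fun j => ?_
    simp only [Matrix.mul_apply, Matrix.of_apply]
    fun_prop
  conv_lhs => rw [← map_mul_gaussianMat hO, lintegral_map (hmeas z) hm]
  rw [← lintegral_const_mul _ (hmeas _)]
  refine lintegral_congr fun G => ?_
  rw [show (Matrix.of fun i k => (O * Matrix.of G) i k) = O * Matrix.of G from rfl,
    rightInv_mul_of_orthogonal hO, euclCLM_mul, hz, ← ENNReal.ofReal_mul (by positivity),
    ← Real.mul_rpow (norm_nonneg _) (norm_nonneg _)]
  have : (EuclideanSpace.single j ‖z‖ : EuclideanSpace ℝ ι) =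
      ‖z‖ • EuclideanSpace.single j (1 : ℝ) := by
    ext i; simp
  rw [this, map_smul, norm_smul, norm_norm]

end GaussianPinvNorm

section GaussianPinvOpNorm

open ProbabilityTheory Module
open scoped Matrix.Norms.L2Operator

variable {ι κ : Type*} [Fintype ι] [Fintype κ] [DecidableEq ι]

theorem exists_norm_eq_opNorm {F G : Type*} [NormedAddCommGroup F] [NormedSpace ℝ F]
    [FiniteDimensional ℝ F] [Nontrivial F] [NormedAddCommGroup G] [NormedSpace ℝ G]
    (T : F →L[ℝ] G) : ∃ u : F, ‖u‖ = 1 ∧ ‖T u‖ = ‖T‖ := by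
  obtain ⟨u0, hu0⟩ := exists_norm_eq F (zero_le_one' ℝ)
  obtain ⟨u, hu, hmax⟩ := (isCompact_sphere (0 : F) 1).exists_isMaxOn
    ⟨u0, by simpa using hu0⟩ (f := fun u => ‖T u‖) (by fun_prop)
  have hu1 : ‖u‖ = 1 := by simpa using hu
  refine ⟨u, hu1, le_antisymm (by simpa [hu1] using T.le_opNorm u) ?_⟩
  exact T.opNorm_le_of_unit_norm (norm_nonneg _) fun v hv => hmax (by simpa using hv)

theorem norm_transpose_matrix [DecidableEq κ] (A : Matrix κ ι ℝ) : ‖Aᵀ‖ = ‖A‖ := by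
  rw [← l2_opNorm_conjTranspose A, conjTranspose_eq_transpose_of_trivial]

theorem lintegral_abs_inner_rpow_stdGaussian {E : Type*} [NormedAddCommGroup E]
    [InnerProductSpace ℝ E] [FiniteDimensional ℝ E] [MeasurableSpace E] [BorelSpace E]
    {y : E} (hy : ‖y‖ = 1) {a : ℝ} (ha : 0 ≤ a) :
    ∫⁻ x, ENNReal.ofReal (|inner ℝ y x| ^ a) ∂(stdGaussian E) =
      ENNReal.ofReal (2 ^ (a / 2) * Real.Gamma ((1 + a) / 2) / Real.Gamma (1 / 2)) := by
  have he : Orthonormal ℝ (fun _ : Unit => y) := by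
    rw [orthonormal_iff_ite]
    intro i j
    simp [hy]
  have h1 := map_inner_stdGaussian he
  have h2 := map_pi_eq_stdGaussian (ι := Unit)
  rw [gaussianVec] at h1
  have h3 := lintegral_norm_rpow_stdGaussian (E := EuclideanSpace ℝ Unit) (a := a)
    (by simp; linarith)
  rw [← h2, ← h1, Measure.map_map (by fun_prop) (by fun_prop),
    lintegral_map (by fun_prop) (by fun_prop)] at h3
  simpa [EuclideanSpace.norm_eq, Real.sqrt_sq_eq_abs] using h3

theorem ofReal_norm_rpow_mul_le [Nonempty κ] (T : Matrix κ ι ℝ) {a : ℝ} (ha : 0 < a) :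
    ENNReal.ofReal (‖T‖ ^ a) *
      ENNReal.ofReal (2 ^ (a / 2) * Real.Gamma ((1 + a) / 2) / Real.Gamma (1 / 2)) ≤
    ∫⁻ z, ENNReal.ofReal (‖euclCLM T z‖ ^ a) ∂(stdGaussian (EuclideanSpace ℝ ι)) := by
  classical
  by_cases hT : ‖T‖ = 0
  · simp [hT, Real.zero_rpow ha.ne']
  obtain ⟨u, hu, hTu⟩ := exists_norm_eq_opNorm (euclCLM Tᵀ)
  rw [norm_euclCLM, norm_transpose_matrix] at hTu
  set y := euclCLM Tᵀ u
  have hy : ‖‖T‖⁻¹ • y‖ = 1 := by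
    rw [norm_smul, norm_inv, norm_norm, hTu, inv_mul_cancel₀ hT]
  rw [← lintegral_abs_inner_rpow_stdGaussian hy ha.le, ← lintegral_const_mul _ (by fun_prop)]
  refine lintegral_mono fun z => ?_
  rw [← ENNReal.ofReal_mul (by positivity), ← Real.mul_rpow (norm_nonneg _) (abs_nonneg _)]
  refine ENNReal.ofReal_le_ofReal (Real.rpow_le_rpow (by positivity) ?_ ha.le)
  rw [real_inner_smul_left, abs_mul, abs_inv, abs_norm, ← mul_assoc, mul_inv_cancel₀ hT, one_mul]
  have : inner ℝ y z = inner ℝ u (euclCLM T z) := by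
    rw [inner_euclCLM, transpose_transpose]
  rw [this]
  simpa [hu] using abs_real_inner_le_norm u (euclCLM T z)

theorem lintegral_norm_rightInv_rpow_le [Nonempty ι] {p : ℕ} (hp0 : 0 < p)
    (hp : Fintype.card κ = Fintype.card ι + p) :
    ∫⁻ G : ι → κ → ℝ, ENNReal.ofReal (‖rightInv (Matrix.of G)‖ ^ (p : ℝ)) ∂(gaussianMat ι κ) ≤
      ENNReal.ofReal (2 ^ (-(p : ℝ) / 2) * Real.pi *
        (Real.Gamma ((Fintype.card ι + p) / 2) / Real.Gamma (Fintype.card ι / 2)) /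
          Real.Gamma ((p + 1) / 2) ^ 2) := by
  have hk : 0 < Fintype.card ι := Fintype.card_pos
  have hk' : (0 : ℝ) < Fintype.card ι := by exact_mod_cast hk
  have hp' : (0 : ℝ) < p := by exact_mod_cast hp0
  have : Nonempty κ := Fintype.card_pos_iff.1 (by omega)
  obtain ⟨j⟩ := (inferInstance : Nonempty ι)
  have hΓ1 : 0 < Real.Gamma (((p : ℝ) + 1) / 2) := Real.Gamma_pos_of_pos (by positivity)
  have hΓ2 : 0 < Real.Gamma ((Fintype.card ι : ℝ) / 2) := Real.Gamma_pos_of_pos (by positivity)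
  have hΓ3 : 0 < Real.Gamma (((Fintype.card ι : ℝ) + p) / 2) :=
    Real.Gamma_pos_of_pos (by positivity)
  set m1 : ℝ := 2 ^ ((p : ℝ) / 2) * Real.Gamma ((1 + p) / 2) / Real.Gamma (1 / 2) with hm1
  have hm1pos : 0 < m1 := by
    rw [hm1, add_comm 1 (p : ℝ), Real.Gamma_one_half_eq]
    positivity
  have hmeasT : ∀ i j, Measurable fun G : ι → κ → ℝ => rightInv (Matrix.of G) i j :=
    measurable_rightInv
  have h1 : (∫⁻ G : ι → κ → ℝ, ENNReal.ofReal (‖rightInv (Matrix.of G)‖ ^ (p : ℝ))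
      ∂(gaussianMat ι κ)) * ENNReal.ofReal m1 ≤
      ∫⁻ G : ι → κ → ℝ, ∫⁻ z, ENNReal.ofReal (‖euclCLM (rightInv (Matrix.of G)) z‖ ^ (p : ℝ))
        ∂(stdGaussian (EuclideanSpace ℝ ι)) ∂(gaussianMat ι κ) := by
    rw [← lintegral_mul_const]
    · exact lintegral_mono fun G => ofReal_norm_rpow_mul_le _ hp'
    · exact ENNReal.measurable_ofReal.comp ((measurable_norm_matrix hmeasT).pow_const _)
  have hjoint : Measurable fun q : (ι → κ → ℝ) × EuclideanSpace ℝ ι =>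
      ENNReal.ofReal (‖euclCLM (rightInv (Matrix.of q.1)) q.2‖ ^ (p : ℝ)) := by
    refine ENNReal.measurable_ofReal.comp ((Measurable.norm ?_).pow_const _)
    have : (fun q : (ι → κ → ℝ) × EuclideanSpace ℝ ι => euclCLM (rightInv (Matrix.of q.1)) q.2) =
        fun q => WithLp.toLp 2 fun i => ∑ j, rightInv (Matrix.of q.1) i j * q.2 j := rfl
    rw [this]
    refine (WithLp.measurable_toLp 2 _).comp (measurable_pi_iff.2 fun i =>
      Finset.measurable_sum _ fun j _ => ((hmeasT i j).comp measurable_fst).mul (by fun_prop))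
  rw [lintegral_lintegral_swap hjoint.aemeasurable] at h1
  rw [lintegral_congr fun z => lintegral_rightInv_rpow j (p : ℝ) z] at h1
  rw [lintegral_mul_const _ (by fun_prop), lintegral_norm_rpow_stdGaussian (by simp; positivity)]
    at h1
  have h2 := h1.trans (mul_le_mul_right (lintegral_rightInv_single_rpow_le j hp hp'
    (by linarith)) _)
  rw [finrank_euclideanSpace, ← ENNReal.ofReal_mul (by positivity)] at h2
  rw [← ENNReal.le_div_iff_mul_le (Or.inl (by simpa using hm1pos)) (Or.inl ENNReal.ofReal_ne_top),
    ← ENNReal.ofReal_div_of_pos hm1pos] at h2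
  refine h2.trans (ENNReal.ofReal_le_ofReal (le_of_eq ?_))
  rw [hm1, add_comm 1 (p : ℝ), Real.Gamma_one_half_eq,
    show ((p : ℝ) + 1 - p) / 2 = 1 / 2 by ring, Real.Gamma_one_half_eq]
  have hs : √Real.pi ≠ 0 := by positivity
  have h2p : (2 : ℝ) ^ ((p : ℝ) / 2) ≠ 0 := by positivity
  have hpi2 : √Real.pi ^ 2 = Real.pi := Real.sq_sqrt Real.pi_pos.le
  field_simp
  rw [hpi2]

end GaussianPinvOpNorm

section GammaEstimates

theorem gamma_add_half_le {x : ℝ} (hx : 0 < x) : Real.Gamma (x + 1 / 2) ≤ Real.Gamma x * √x := by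
  have h := Real.Gamma_mul_add_mul_le_rpow_Gamma_mul_rpow_Gamma hx (by linarith : 0 < x + 1)
    (by norm_num : (0 : ℝ) < 1 / 2) (by norm_num : (0 : ℝ) < 1 / 2) (by norm_num)
  have hG := Real.Gamma_pos_of_pos hx
  rw [Real.Gamma_add_one hx.ne', ← Real.sqrt_eq_rpow, ← Real.sqrt_eq_rpow,
    Real.sqrt_mul hx.le, mul_left_comm, Real.mul_self_sqrt hG.le] at h
  rw [show x + 1 / 2 = 1 / 2 * x + 1 / 2 * (x + 1) by ring, mul_comm (Real.Gamma x)]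
  exact h

theorem gamma_add_half_mul_le {x : ℝ} (hx : 0 < x) (p : ℕ) :
    Real.Gamma (x + p / 2) ≤ Real.Gamma x * √(x + p / 2) ^ p := by
  induction p with
  | zero => simp
  | succ p ih =>
    have h := gamma_add_half_le (x := x + p / 2) (by positivity)
    have hG := Real.Gamma_pos_of_pos hx
    have hs : √(x + p / 2) ≤ √(x + (p + 1 : ℕ) / 2) := by
      apply Real.sqrt_le_sqrt
      push_cast
      linarith
    calc Real.Gamma (x + (p + 1 : ℕ) / 2) = Real.Gamma (x + p / 2 + 1 / 2) := by
          congr 1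
          push_cast
          ring
      _ ≤ Real.Gamma (x + p / 2) * √(x + p / 2) := h
      _ ≤ Real.Gamma x * √(x + p / 2) ^ p * √(x + p / 2) := by gcongr
      _ = Real.Gamma x * √(x + p / 2) ^ (p + 1) := by ring
      _ ≤ _ := by gcongr

theorem pi_mul_le_gamma_sq {p : ℕ} (hp : 0 < p) :
    Real.pi * (p / (2 * Real.exp 1)) ^ p ≤ Real.Gamma ((p + 1) / 2) ^ 2 := by
  have hp' : (1 : ℝ) ≤ p := by exact_mod_cast hp
  set D := Real.Gamma (((p : ℝ) + 1) / 2) with hD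
  have hDpos : 0 < D := Real.Gamma_pos_of_pos (by positivity)
  have h1 := Real.Gamma_mul_Gamma_add_half (((p : ℝ) + 1) / 2)
  rw [show 2 * (((p : ℝ) + 1) / 2) = p + 1 by ring, Real.Gamma_nat_eq_factorial,
    show 1 - ((p : ℝ) + 1) = -p by ring, ← hD] at h1
  have h2 := gamma_add_half_le (x := ((p : ℝ) + 1) / 2) (by positivity)
  rw [← hD] at h2
  have h3 := Stirling.le_factorial_stirling p
  have h4 : √(2 * Real.pi * p) * (p / Real.exp 1) ^ p * (2 : ℝ) ^ (-(p : ℝ)) * √Real.pi ≤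
      D ^ 2 * √(((p : ℝ) + 1) / 2) := by
    calc _ ≤ (p.factorial : ℝ) * (2 : ℝ) ^ (-(p : ℝ)) * √Real.pi := by gcongr
      _ = D * Real.Gamma (((p : ℝ) + 1) / 2 + 1 / 2) := h1.symm
      _ ≤ D * (D * √(((p : ℝ) + 1) / 2)) := by gcongr
      _ = _ := by ring
  have h5 : √Real.pi * √(((p : ℝ) + 1) / 2) ≤ √(2 * Real.pi * p) := by
    rw [← Real.sqrt_mul Real.pi_pos.le]
    apply Real.sqrt_le_sqrt
    nlinarith [Real.pi_pos]
  have h6 : Real.pi * (p / (2 * Real.exp 1)) ^ p =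
      √Real.pi * (p / Real.exp 1) ^ p * (2 : ℝ) ^ (-(p : ℝ)) * √Real.pi := by
    have := Real.mul_self_sqrt Real.pi_pos.le
    rw [Real.rpow_neg (by norm_num), Real.rpow_natCast]
    nth_rewrite 1 [← this]
    rw [mul_comm 2 (Real.exp 1), ← div_div, div_pow _ (2 : ℝ)]
    ring
  have hs : 0 < √(((p : ℝ) + 1) / 2) := by positivity
  rw [h6]
  refine le_of_mul_le_mul_right ?_ hs
  refine le_trans ?_ h4
  calc _ = (√Real.pi * √(((p : ℝ) + 1) / 2)) * (p / Real.exp 1) ^ p * (2 : ℝ) ^ (-(p : ℝ)) *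
        √Real.pi := by ring
    _ ≤ _ := by gcongr

theorem gamma_ratio_le {k p : ℕ} (hk : 0 < k) (hp : 0 < p) :
    2 ^ (-(p : ℝ) / 2) * Real.pi * (Real.Gamma (((k : ℝ) + p) / 2) / Real.Gamma ((k : ℝ) / 2)) /
      Real.Gamma ((p + 1) / 2) ^ 2 ≤ (Real.exp 1 * √((k : ℝ) + p) / p) ^ p := by
  have hk' : (0 : ℝ) < k := by exact_mod_cast hk
  have hp' : (0 : ℝ) < p := by exact_mod_cast hp
  have h1 := gamma_add_half_mul_le (x := (k : ℝ) / 2) (by positivity) p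
  have h2 := pi_mul_le_gamma_sq hp
  have hG : 0 < Real.Gamma ((k : ℝ) / 2) := Real.Gamma_pos_of_pos (by positivity)
  have hpi := Real.pi_pos
  have h3 : Real.Gamma (((k : ℝ) + p) / 2) / Real.Gamma ((k : ℝ) / 2) ≤
      √(((k : ℝ) + p) / 2) ^ p := by
    rw [← add_div] at h1
    rwa [div_le_iff₀ hG, mul_comm]
  have h4 : (2 : ℝ) ^ (-(p : ℝ) / 2) = (√2 ^ p)⁻¹ := by
    rw [neg_div, Real.rpow_neg (by norm_num), Real.sqrt_eq_rpow,
        ← Real.rpow_mul_natCast (by norm_num)]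
    congr 2
    ring
  calc _ ≤ 2 ^ (-(p : ℝ) / 2) * Real.pi * √(((k : ℝ) + p) / 2) ^ p /
        (Real.pi * (p / (2 * Real.exp 1)) ^ p) := by gcongr
    _ = _ := by
      rw [h4, Real.sqrt_div (by positivity), div_pow, div_pow, div_pow, mul_pow, mul_pow]
      have : (√2 ^ p) * (√2 ^ p) = 2 ^ p := by rw [← mul_pow]; norm_num
      field_simp
      rw [← this]
      ring

end GammaEstimates

section GaussianFullRank

open ProbabilityTheory Module
open scoped Matrix.Norms.L2Operator

variable {ι κ : Type*} [Fintype ι] [Fintype κ]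

theorem lintegral_ofReal_le_of_rpow {Ω : Type*} [MeasurableSpace Ω] {μ : Measure Ω}
    [IsProbabilityMeasure μ] {f : Ω → ℝ} (hf : Measurable f) (hf0 : ∀ ω, 0 ≤ f ω) {s c : ℝ}
    (hs : 1 ≤ s) (hc : 0 ≤ c)
    (h : ∫⁻ ω, ENNReal.ofReal (f ω ^ s) ∂μ ≤ ENNReal.ofReal (c ^ s)) :
    ∫⁻ ω, ENNReal.ofReal (f ω) ∂μ ≤ ENNReal.ofReal c := by
  have hs0 : 0 < s := by linarith
  have h1 := eLpNorm'_le_eLpNorm'_of_exponent_le (f := f) zero_lt_one hs μ hf.aestronglyMeasurable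
  rw [eLpNorm'_eq_lintegral_enorm, eLpNorm'_eq_lintegral_enorm] at h1
  simp only [ENNReal.rpow_one, div_one, Real.enorm_of_nonneg (hf0 _)] at h1
  refine h1.trans ?_
  simp only [ENNReal.ofReal_rpow_of_nonneg (hf0 _) hs0.le]
  calc _ ≤ ENNReal.ofReal (c ^ s) ^ (1 / s) := by gcongr
    _ = _ := by
      rw [← ENNReal.ofReal_rpow_of_nonneg hc hs0.le, ← ENNReal.rpow_mul,
        mul_one_div_cancel hs0.ne', ENNReal.rpow_one]

theorem lintegral_norm_rightInv_le [DecidableEq ι] [Nonempty ι] {p : ℕ} (hp0 : 0 < p)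
    (hp : Fintype.card κ = Fintype.card ι + p) :
    ∫⁻ G : ι → κ → ℝ, ENNReal.ofReal ‖rightInv (Matrix.of G)‖ ∂(gaussianMat ι κ) ≤
      ENNReal.ofReal (Real.exp 1 * √((Fintype.card ι : ℝ) + p) / p) := by
  refine lintegral_ofReal_le_of_rpow (measurable_norm_matrix measurable_rightInv)
    (fun _ => norm_nonneg _) (s := p) (by exact_mod_cast hp0) (by positivity) ?_
  refine (lintegral_norm_rightInv_rpow_le hp0 hp).trans (ENNReal.ofReal_le_ofReal ?_)
  rw [Real.rpow_natCast]
  exact gamma_ratio_le Fintype.card_pos hp0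

theorem lintegral_sqrt_rightInv_sum_sq_le [DecidableEq ι] {p : ℕ}
    (hp : Fintype.card κ = Fintype.card ι + p) (hp2 : 2 ≤ p) :
    ∫⁻ G : ι → κ → ℝ, ENNReal.ofReal √(∑ i, ∑ j, rightInv (Matrix.of G) i j ^ 2)
        ∂(gaussianMat ι κ) ≤ ENNReal.ofReal √(Fintype.card ι / ((p : ℝ) - 1)) := by
  have hp' : (2 : ℝ) ≤ p := by exact_mod_cast hp2
  have hnn : ∀ M : Matrix κ ι ℝ, 0 ≤ ∑ i, ∑ j, M i j ^ 2 := fun M => by positivity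
  refine lintegral_ofReal_le_of_rpow ?_ (fun _ => Real.sqrt_nonneg _) (s := 2) (by norm_num)
    (Real.sqrt_nonneg _) ?_
  · exact (Finset.measurable_sum _ fun i _ => Finset.measurable_sum _ fun j _ =>
      (measurable_rightInv i j).pow_const 2).sqrt
  · simp only [Real.rpow_two, Real.sq_sqrt (hnn _)]
    rw [Real.sq_sqrt (div_nonneg (by positivity) (by linarith))]
    exact lintegral_rightInv_sum_sq_le hp hp2

theorem gaussianVec_span_eq_zero {l : Type*} [Fintype l] (g : l → κ → ℝ)
    (hl : Fintype.card l < Fintype.card κ) :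
    gaussianVec κ {x | x ∈ Submodule.span ℝ (Set.range g)} = 0 := by
  obtain ⟨e, he, hge⟩ := exists_orthonormal_orthogonal
    (fun i => (WithLp.toLp 2 (g i) : EuclideanSpace ℝ κ)) (d := 1) (by
      rw [finrank_euclideanSpace]; omega)
  have h1 := ae_ne_zero_stdGaussian (E := EuclideanSpace ℝ (Fin 1))
  rw [← map_inner_gaussianVec he] at h1
  have h2 := ae_of_ae_map (Measurable.aemeasurable (by fun_prop)) h1
  refine measure_mono_null ?_ h2
  intro x hx
  simp only [Set.mem_ofPred_eq, Set.mem_compl_iff, not_not] at hx ⊢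
  ext i
  simp only [PiLp.zero_apply]
  induction hx using Submodule.span_induction with
  | mem y hy =>
    obtain ⟨j, rfl⟩ := hy
    rw [real_inner_comm, hge]
  | zero => simp
  | add y z _ _ h h' => rw [WithLp.toLp_add, inner_add_right, h, h', add_zero]
  | smul a y _ h => rw [WithLp.toLp_smul, inner_smul_right, h, mul_zero]

theorem measurableSet_linearIndepOn (s : Finset ι) :
    MeasurableSet {G : ι → κ → ℝ | LinearIndepOn ℝ G s} := by
  have h1 := isOpen_setOfPred_linearIndependent (𝕜 := ℝ) (E := κ → ℝ) (ι := s)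
  have h2 : Measurable fun (G : ι → κ → ℝ) (i : s) => G i := by fun_prop
  exact h2 h1.measurableSet

theorem ae_linearIndepOn_gaussianMat (h : Fintype.card ι ≤ Fintype.card κ) (s : Finset ι) :
    ∀ᵐ G ∂(gaussianMat ι κ), LinearIndepOn ℝ G s := by
  classical
  induction s using Finset.induction_on with
  | empty => simp
  | insert j s hj ih =>
    have hsub : ∀ᵐ G ∂(gaussianMat ι κ),
        G ∉ {G | LinearIndepOn ℝ G s ∧ ¬ LinearIndepOn ℝ G (insert j s : Finset ι)} := by
      have hm : MeasurableSet {G : ι → κ → ℝ | LinearIndepOn ℝ G s ∧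
          ¬ LinearIndepOn ℝ G (insert j s : Finset ι)} :=
        (measurableSet_linearIndepOn s).inter (measurableSet_linearIndepOn (insert j s)).compl
      rw [← measure_eq_zero_iff_ae_notMem, ← lintegral_indicator_one hm]
      refine le_antisymm (lintegral_gaussianMat_le (measurable_one.indicator hm) j fun G => ?_)
        bot_le
      have h0 := gaussianVec_span_eq_zero (fun i : s => G i) (by
        have := Finset.card_lt_univ_of_notMem hj
        rw [Fintype.card_coe]
        omega)
      refine le_of_eq ((lintegral_eq_zero_iff' ?_).2 ?_)
      · exact ((measurable_one.indicator hm).comp (measurable_update G)).aemeasurable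
      · filter_upwards [measure_eq_zero_iff_ae_notMem.1 h0] with g hg
        refine Set.indicator_of_notMem ?_ _
        rintro ⟨ha, hb⟩
        apply hb
        rw [Finset.coe_insert, linearIndepOn_insert (by simpa using hj)]
        refine ⟨ha, ?_⟩
        have himg : Function.update G j g '' s = Set.range fun i : s => G i := by
          refine (Set.image_congr (g := G) fun i hi => Function.update_of_ne ?_ _ _).trans
            (Set.image_eq_range G s)
          rintro rfl
          exact hj hi
        rw [Function.update_self, himg]
        exact hg
    filter_upwards [ih, hsub] with G h1 h2
    by_contra h3
    exact h2 ⟨h1, h3⟩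

theorem ae_det_mul_transpose_ne_zero [DecidableEq ι] (h : Fintype.card ι ≤ Fintype.card κ) :
    ∀ᵐ G ∂(gaussianMat ι κ), (Matrix.of G * (Matrix.of G)ᵀ).det ≠ 0 := by
  filter_upwards [ae_linearIndepOn_gaussianMat h Finset.univ] with G hG
  rw [Finset.coe_univ, linearIndepOn_univ_iff] at hG
  have h1 := Matrix.PosDef.mul_conjTranspose_self (Matrix.of G)
    (Matrix.vecMul_injective_iff.2 hG)
  rw [conjTranspose_eq_transpose_of_trivial] at h1
  exact h1.det_pos.ne'

end GaussianFullRank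

section SpectralBounds

open Module
open scoped Matrix.Norms.L2Operator

variable {ι κ l : Type*} [Fintype ι] [Fintype κ] [Fintype l] [DecidableEq κ]

theorem euclCLM_sub_apply (A B : Matrix ι κ ℝ) (x : EuclideanSpace ℝ κ) :
    euclCLM (A - B) x = euclCLM A x - euclCLM B x := by
  ext i; simp

theorem euclCLM_injective : Function.Injective (euclCLM : Matrix ι κ ℝ → _) :=
  LinearMap.toContinuousLinearMap.injective.comp Matrix.toEuclideanLin.injective

theorem norm_euclCLM_le (A : Matrix ι κ ℝ) (x : EuclideanSpace ℝ κ) :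
    ‖euclCLM A x‖ ≤ ‖A‖ * ‖x‖ := (euclCLM A).le_opNorm x

theorem norm_matrix_le {A : Matrix ι κ ℝ} {c : ℝ} (hc : 0 ≤ c)
    (h : ∀ x, ‖euclCLM A x‖ ≤ c * ‖x‖) : ‖A‖ ≤ c :=
  (euclCLM A).opNorm_le_bound hc h

variable [DecidableEq ι]

theorem euclCLM_one (x : EuclideanSpace ℝ ι) : euclCLM (1 : Matrix ι ι ℝ) x = x := by
  ext i; simp

theorem exists_spectral_basis {d : ℕ} {H : Matrix (Fin d) (Fin d) ℝ} (hH : Hᵀ = H) :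
    ∃ (v : OrthonormalBasis (Fin d) ℝ (EuclideanSpace ℝ (Fin d))) (μ : Fin d → ℝ),
      Antitone μ ∧ ∀ i, euclCLM H (v i) = μ i • v i := by
  have hs : (euclCLM H : EuclideanSpace ℝ (Fin d) →ₗ[ℝ] EuclideanSpace ℝ (Fin d)).IsSymmetric := by
    intro x y
    have := inner_euclCLM H x y
    rwa [hH] at this
  exact ⟨hs.eigenvectorBasis (by simp), hs.eigenvalues (by simp),
    hs.eigenvalues_antitone _, fun i => hs.apply_eigenvectorBasis _ i⟩

theorem inner_pow_euclCLM {H : Matrix ι ι ℝ} (hH : Hᵀ = H)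
    (v : OrthonormalBasis l ℝ (EuclideanSpace ℝ ι)) {μ : l → ℝ}
    (hv : ∀ i, euclCLM H (v i) = μ i • v i) (j : ℕ) (y : EuclideanSpace ℝ ι) :
    inner ℝ (euclCLM (H ^ j) y) y = ∑ i, μ i ^ j * inner ℝ (v i) y ^ 2 := by
  have h1 : ∀ i, euclCLM (H ^ j) (v i) = μ i ^ j • v i := by
    intro i
    induction j with
    | zero => rw [pow_zero, pow_zero, euclCLM_one, one_smul]
    | succ j ih => rw [pow_succ, euclCLM_mul, hv, map_smul, ih, smul_smul, pow_succ']
  rw [← v.sum_inner_mul_inner]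
  refine Finset.sum_congr rfl fun i _ => ?_
  rw [inner_euclCLM, Matrix.transpose_pow, hH, h1, inner_smul_right, real_inner_comm]
  ring

theorem norm_sq_euclCLM (A : Matrix ι κ ℝ) (x : EuclideanSpace ℝ κ) :
    ‖euclCLM A x‖ ^ 2 = inner ℝ (euclCLM (Aᵀ * A) x) x := by
  rw [euclCLM_mul, inner_euclCLM, transpose_transpose, real_inner_self_eq_norm_sq]

/-- A power-mean inequality for positive semidefinite matrices. -/
theorem inner_euclCLM_pow_le {d : ℕ} (A : Matrix κ (Fin d) ℝ) (s : ℕ) (hs : s ≠ 0)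
    {y : EuclideanSpace ℝ (Fin d)} (hy : ‖y‖ ≤ 1) :
    inner ℝ (euclCLM (Aᵀ * A) y) y ^ s ≤ inner ℝ (euclCLM ((Aᵀ * A) ^ s) y) y := by
  have hH : (Aᵀ * A)ᵀ = Aᵀ * A := by simp
  obtain ⟨v, μ, -, hv⟩ := exists_spectral_basis hH
  have hμ : ∀ i, 0 ≤ μ i := by
    intro i
    have := norm_sq_euclCLM A (v i)
    rw [hv, inner_smul_left, real_inner_self_eq_norm_sq, v.orthonormal.1 i] at this
    simp only [conj_trivial, one_pow, mul_one] at this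
    rw [← this]; positivity
  have h1 := inner_pow_euclCLM hH v hv 1 y
  rw [pow_one] at h1
  rw [h1, inner_pow_euclCLM hH v hv s y]
  simp only [pow_one]
  rcases eq_or_ne y 0 with rfl | hy0
  · simp [hs]
  have hyp : 0 < ‖y‖ := norm_pos_iff.2 hy0
  have hsum : ∑ i, inner ℝ (v i) y ^ 2 = ‖y‖ ^ 2 := by
    rw [← v.sum_sq_norm_inner_right y]
    simp
  have h2 := Real.pow_arith_mean_le_arith_mean_pow Finset.univ
    (fun i => inner ℝ (v i) y ^ 2 / ‖y‖ ^ 2) μ (fun i _ => by positivity)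
    (by rw [← Finset.sum_div, hsum, div_self (by positivity)]) (fun i _ => hμ i) s
  have h3 : ∀ f : Fin d → ℝ, ∑ i, inner ℝ (v i) y ^ 2 / ‖y‖ ^ 2 * f i =
      (∑ i, f i * inner ℝ (v i) y ^ 2) / ‖y‖ ^ 2 := by
    intro f
    rw [Finset.sum_div]
    exact Finset.sum_congr rfl fun i _ => by ring
  rw [h3, h3 fun i => μ i ^ s, div_pow, div_le_div_iff₀ (by positivity) (by positivity)] at h2
  set a := (∑ i, μ i * inner ℝ (v i) y ^ 2) ^ s
  set b := ∑ i, μ i ^ s * inner ℝ (v i) y ^ 2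
  have hb : 0 ≤ b := Finset.sum_nonneg fun i _ => mul_nonneg (pow_nonneg (hμ i) _) (by positivity)
  have h4 : (‖y‖ ^ 2) ^ s ≤ ‖y‖ ^ 2 :=
    (pow_le_pow_of_le_one (by positivity) (pow_le_one₀ hyp.le hy)
        (Nat.one_le_iff_ne_zero.2 hs)).trans
      (by rw [pow_one])
  exact le_of_mul_le_mul_right (h2.trans (mul_le_mul_of_nonneg_left h4 hb)) (by positivity)

/-- The easy half of the Courant–Fischer–Weyl principle for approximation by matrices of small
rank. -/
theorem eigenvalue_le_norm_sub_sq {d : ℕ} {A X : Matrix ι (Fin d) ℝ}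
    (v : OrthonormalBasis (Fin d) ℝ (EuclideanSpace ℝ (Fin d))) {μ : Fin d → ℝ} (hμ : Antitone μ)
    (hv : ∀ i, euclCLM (Aᵀ * A) (v i) = μ i • v i) (i : Fin d) (hX : X.rank ≤ i) :
    μ i ≤ ‖A - X‖ ^ 2 := by
  have hi : (i : ℕ) + 1 ≤ d := i.2
  let W : Matrix (Fin d) (Fin (i + 1)) ℝ := Matrix.of fun a j => v (Fin.castLE hi j) a
  have hker : LinearMap.ker (X * W).mulVecLin ≠ ⊥ := by
    intro h
    have h1 := (X * W).mulVecLin.finrank_range_add_finrank_ker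
    rw [h, finrank_bot, Module.finrank_fin_fun] at h1
    have h2 : (X * W).rank ≤ X.rank := Matrix.rank_mul_le_left X W
    rw [Matrix.rank] at h2
    omega
  obtain ⟨c, hc, hc0⟩ := Submodule.exists_mem_ne_zero_of_ne_bot hker
  have hc1 : X *ᵥ (W *ᵥ c) = 0 := by
    rw [Matrix.mulVec_mulVec]
    exact hc
  set w : EuclideanSpace ℝ (Fin d) := WithLp.toLp 2 (W *ᵥ c) with hw
  have hwsum : w = ∑ j, c j • v (Fin.castLE hi j) := by
    ext a
    simp [hw, W, Matrix.mulVec, dotProduct, mul_comm]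
  have hAX : euclCLM (A - X) w = euclCLM A w := by
    rw [euclCLM_sub_apply]
    have : euclCLM X w = 0 := by
      ext a
      simpa [hw] using congrFun hc1 a
    rw [this, sub_zero]
  have hinner : ∀ a : Fin d, (i : ℕ) < a → inner ℝ (v a) w = 0 := by
    intro a ha
    rw [hwsum, inner_sum]
    refine Finset.sum_eq_zero fun j _ => ?_
    rw [inner_smul_right, v.orthonormal.2, mul_zero]
    intro h
    have := congrArg Fin.val h
    simp at this
    omega
  have hw0 : w ≠ 0 := by
    intro h0
    apply hc0
    have hli := (v.orthonormal.comp (Fin.castLE hi) (Fin.castLE_injective hi)).linearIndependent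
    rw [Fintype.linearIndependent_iff] at hli
    exact funext fun j => hli c (by rw [← h0, hwsum]; rfl) j
  have hH : (Aᵀ * A)ᵀ = Aᵀ * A := by simp
  have h1 := inner_pow_euclCLM hH v hv 1 w
  rw [pow_one, ← norm_sq_euclCLM] at h1
  have hsum : ∑ a, inner ℝ (v a) w ^ 2 = ‖w‖ ^ 2 := by
    rw [← v.sum_sq_norm_inner_right w]
    simp
  have h2 : μ i * ‖w‖ ^ 2 ≤ ‖euclCLM A w‖ ^ 2 := by
    rw [h1, ← hsum, Finset.mul_sum]
    refine Finset.sum_le_sum fun a _ => ?_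
    rw [pow_one]
    rcases lt_or_ge (i : ℕ) a with ha | ha
    · simp [hinner a ha]
    · exact mul_le_mul_of_nonneg_right (hμ ha) (by positivity)
  have h3 := norm_euclCLM_le (A - X) w
  rw [hAX] at h3
  have h4 : ‖euclCLM A w‖ ^ 2 ≤ (‖A - X‖ * ‖w‖) ^ 2 := by gcongr
  rw [mul_pow] at h4
  exact le_of_mul_le_mul_right (h2.trans h4) (by positivity)

theorem exists_projection_matrix (M : Matrix ι κ ℝ) :
    ∃ Z : Matrix κ ι ℝ, (M * Z)ᵀ = M * Z ∧ M * Z * M = M ∧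
      ∀ x, ‖x - euclCLM (M * Z) x‖ ≤ ‖x‖ := by
  set S := LinearMap.range (euclCLM M : EuclideanSpace ℝ κ →ₗ[ℝ] EuclideanSpace ℝ ι) with hS
  have hz : ∀ i : ι, ∃ z, euclCLM M z = S.starProjection (EuclideanSpace.single i 1) :=
    fun i => S.starProjection_apply_mem _
  choose z hz using hz
  let Z : Matrix κ ι ℝ := Matrix.of fun a i => z i a
  have hZ : euclCLM (M * Z) = S.starProjection := by
    apply ContinuousLinearMap.coe_injective
    refine (EuclideanSpace.basisFun ι ℝ).toBasis.ext fun i => ?_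
    have : euclCLM Z (EuclideanSpace.single i 1) = z i := by
      ext a; simp [Z]
    simp only [OrthonormalBasis.coe_toBasis, EuclideanSpace.basisFun_apply,
      ContinuousLinearMap.coe_coe]
    rw [euclCLM_mul, this, hz]
  refine ⟨Z, ?_, ?_, ?_⟩
  · apply euclCLM_injective
    ext1 x
    refine ext_inner_left ℝ fun y => ?_
    rw [← inner_euclCLM, hZ]
    exact S.starProjection_isSymmetric y x
  · apply euclCLM_injective
    ext1 x
    rw [euclCLM_mul, hZ]
    exact Submodule.starProjection_eq_self_iff.2 ⟨x, rfl⟩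
  · intro x
    rw [hZ]
    rw [← Submodule.starProjection_orthogonal_val]
    exact Sᗮ.norm_starProjection_apply_le x

end SpectralBounds

section PowerIteration

open Module
open scoped Matrix.Norms.L2Operator

theorem mul_transpose_pow_mul {ι κ : Type*} [Fintype ι] [Fintype κ] [DecidableEq ι] [DecidableEq κ]
    (A : Matrix ι κ ℝ) (q : ℕ) : (A * Aᵀ) ^ q * A = A * (Aᵀ * A) ^ q := by
  induction q with
  | zero => simp
  | succ q ih =>
    rw [pow_succ, pow_succ (Aᵀ * A), ← Matrix.mul_assoc A, ← ih]
    simp only [Matrix.mul_assoc]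

theorem norm_sub_mul_pow_le {m n : ℕ} (A M : Matrix (Fin m) (Fin n) ℝ) (q : ℕ) :
    ∃ Z : Matrix (Fin n) (Fin n) ℝ,
      ‖A - M * Z‖ ^ (2 * q + 1) ≤ ‖(A * Aᵀ) ^ q * A - M‖ := by
  obtain ⟨Z, hZ1, hZ2, hZ3⟩ := exists_projection_matrix M
  refine ⟨Z * A, ?_⟩
  rcases isEmpty_or_nonempty (Fin m) with hm | hm
  · have : A - M * (Z * A) = 0 := Subsingleton.elim _ _
    rw [this]
    simp
  obtain ⟨y, hy, hyn⟩ := exists_norm_eq_opNorm (euclCLM (A - M * (Z * A))ᵀ)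
  set z := y - euclCLM (M * Z) y with hz
  have hz1 : ‖z‖ ≤ 1 := hy ▸ hZ3 y
  have e1 : euclCLM (A - M * (Z * A))ᵀ y = euclCLM Aᵀ z := by
    rw [hz, map_sub, ← euclCLM_mul, ← euclCLM_sub_apply, ← Matrix.mul_assoc, Matrix.transpose_sub,
      Matrix.transpose_mul, hZ1]
  have e2 : euclCLM Mᵀ z = 0 := by
    rw [hz, map_sub, ← euclCLM_mul, ← hZ1, ← Matrix.transpose_mul, hZ2, sub_self]
  set B := (A * Aᵀ) ^ q * A with hB
  have e3 : (Bᵀ)ᵀ * Bᵀ = ((Aᵀ)ᵀ * Aᵀ) ^ (2 * q + 1) := by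
    rw [transpose_transpose, transpose_transpose, hB, Matrix.transpose_mul, Matrix.transpose_pow,
      Matrix.transpose_mul, transpose_transpose, Matrix.mul_assoc, ← Matrix.mul_assoc A,
      ← pow_succ', ← pow_add]
    congr 1
    omega
  have h1 := inner_euclCLM_pow_le Aᵀ (2 * q + 1) (by omega) hz1
  rw [← norm_sq_euclCLM, ← e3, ← norm_sq_euclCLM] at h1
  have h2 : ‖euclCLM Bᵀ z‖ ≤ ‖B - M‖ := by
    have h3 := norm_euclCLM_le (B - M)ᵀ z
    rw [Matrix.transpose_sub, euclCLM_sub_apply, e2, sub_zero, ← Matrix.transpose_sub,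
      norm_transpose_matrix] at h3
    exact h3.trans (mul_le_of_le_one_right (norm_nonneg _) hz1)
  rw [← norm_transpose_matrix, ← norm_euclCLM, ← hyn, e1]
  refine le_trans ?_ h2
  rw [← pow_le_pow_iff_left₀ (by positivity) (norm_nonneg _) two_ne_zero, ← pow_mul, mul_comm,
    pow_mul]
  exact h1

/-- The right singular vectors of `A` belonging to its nonzero singular values, in decreasing
order and with the first `k` of them separated from the others. -/
theorem exists_singular_rows {m n k : ℕ} (A : Matrix (Fin m) (Fin n) ℝ) (hk : k < A.rank) :
    ∃ O : Matrix (Fin k ⊕ Fin (A.rank - k)) (Fin n) ℝ, O * Oᵀ = 1 ∧ ∃ σ : ℝ, 0 ≤ σ ∧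
      (∀ X : Matrix (Fin m) (Fin n) ℝ, X.rank ≤ k → σ ≤ ‖A - X‖) ∧
      ∀ (q : ℕ) (y : EuclideanSpace ℝ (Fin n)), euclCLM (O.submatrix Sum.inl id) y = 0 →
        ‖euclCLM ((A * Aᵀ) ^ q * A) y‖ ≤
          σ ^ (2 * q + 1) * ‖euclCLM (O.submatrix Sum.inr id) y‖ := by
  have hH : (Aᵀ * A)ᵀ = Aᵀ * A := by simp
  obtain ⟨v, μ, hμ, hv⟩ := exists_spectral_basis hH
  have hn : A.rank ≤ n := by simpa using A.rank_le_card_width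
  have hkn : k < n := by omega
  let e : Fin k ⊕ Fin (A.rank - k) → Fin n := fun i =>
    Fin.castLE (by omega : k + (A.rank - k) ≤ n) (finSumFinEquiv i)
  have he : Function.Injective e := (Fin.castLE_injective _).comp finSumFinEquiv.injective
  have hμ0 : ∀ i, 0 ≤ μ i := by
    intro i
    have := norm_sq_euclCLM A (v i)
    rw [hv, inner_smul_left, real_inner_self_eq_norm_sq, v.orthonormal.1 i] at this
    simp only [conj_trivial, one_pow, mul_one] at this
    rw [← this]; positivity
  have hμz : ∀ i, i ∉ Set.range e → μ i = 0 := by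
    intro i hi
    have hAi : A.rank ≤ i := by
      by_contra! h
      exact hi ⟨finSumFinEquiv.symm ⟨i, by omega⟩, by simp [e]⟩
    have := eigenvalue_le_norm_sub_sq v hμ hv i hAi
    rw [sub_self, norm_zero] at this
    exact le_antisymm (by simpa using this) (hμ0 i)
  let O : Matrix (Fin k ⊕ Fin (A.rank - k)) (Fin n) ℝ := Matrix.of fun i a => v (e i) a
  have hO : ∀ i y, euclCLM O y i = inner ℝ (v (e i)) y := by
    intro i y
    simp [O, Matrix.mulVec, dotProduct, PiLp.inner_apply, mul_comm]
  refine ⟨O, ?_, √(μ ⟨k, hkn⟩), Real.sqrt_nonneg _, ?_, ?_⟩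
  · ext i j
    have := orthonormal_iff_ite.1 (v.orthonormal.comp e he) i j
    simp only [Function.comp_apply, PiLp.inner_apply] at this
    rw [Matrix.one_apply, ← this]
    simp [O, Matrix.mul_apply, mul_comm]
  · intro X hX
    exact Real.sqrt_le_iff.2 ⟨norm_nonneg _, eigenvalue_le_norm_sub_sq v hμ hv ⟨k, hkn⟩ hX⟩
  · intro q y hy
    have hy1 : ∀ j, inner ℝ (v (e (Sum.inl j))) y = 0 := by
      intro j
      rw [← hO]
      exact congrArg (fun x => x j) hy
    have hB : ((A * Aᵀ) ^ q * A)ᵀ * ((A * Aᵀ) ^ q * A) = (Aᵀ * A) ^ (2 * q + 1) := by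
      rw [mul_transpose_pow_mul, Matrix.transpose_mul, Matrix.transpose_pow, hH, Matrix.mul_assoc,
        ← Matrix.mul_assoc Aᵀ, ← pow_succ', ← pow_add]
      congr 1
      omega
    have h1 : ‖euclCLM ((A * Aᵀ) ^ q * A) y‖ ^ 2 =
        ∑ j : Fin (A.rank - k), μ (e (Sum.inr j)) ^ (2 * q + 1) *
          inner ℝ (v (e (Sum.inr j))) y ^ 2 := by
      rw [norm_sq_euclCLM, hB, inner_pow_euclCLM hH v hv,
        ← Finset.sum_subset (Finset.subset_univ (Finset.univ.map ⟨e, he⟩)), Finset.sum_map,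
        Fintype.sum_sum_type]
      · simp [hy1]
      · intro i _ hi
        rw [hμz i (by simpa using hi)]
        simp
    have h2 : ‖euclCLM (O.submatrix Sum.inr id) y‖ ^ 2 =
        ∑ j : Fin (A.rank - k), inner ℝ (v (e (Sum.inr j))) y ^ 2 := by
      rw [EuclideanSpace.real_norm_sq_eq]
      refine Finset.sum_congr rfl fun j _ => ?_
      rw [← hO]
      rfl
    rw [← pow_le_pow_iff_left₀ (norm_nonneg _) (by positivity) two_ne_zero, mul_pow, h1, h2,
      ← pow_mul, mul_comm (2 * q + 1), pow_mul, Real.sq_sqrt (hμ0 _), Finset.mul_sum]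
    refine Finset.sum_le_sum fun j _ => ?_
    have := hμ0 (e (Sum.inr j))
    gcongr
    refine hμ ?_
    simp [e, Fin.le_def]

theorem exists_low_rank_approx {m n k r N : ℕ} (A : Matrix (Fin m) (Fin n) ℝ)
    {O : Matrix (Fin k ⊕ Fin N) (Fin n) ℝ} (hO : O * Oᵀ = 1) {σ : ℝ} (hσ : 0 ≤ σ) (q : ℕ)
    (h : ∀ (y : EuclideanSpace ℝ (Fin n)), euclCLM (O.submatrix Sum.inl id) y = 0 →
        ‖euclCLM ((A * Aᵀ) ^ q * A) y‖ ≤ σ ^ (2 * q + 1) * ‖euclCLM (O.submatrix Sum.inr id) y‖)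
    (R : Matrix (Fin n) (Fin r) ℝ) {G₁ : Matrix (Fin k) (Fin r) ℝ} {G₂ : Matrix (Fin N) (Fin r) ℝ}
    (hG₁ : O.submatrix Sum.inl id * R = G₁) (hG₂ : O.submatrix Sum.inr id * R = G₂)
    (hdet : (G₁ * G₁ᵀ).det ≠ 0) :
    ∃ X : Matrix (Fin m) (Fin n) ℝ, X.rank ≤ k ∧
      LinearMap.range X.mulVecLin ≤ LinearMap.range ((A * Aᵀ) ^ q * A * R).mulVecLin ∧
      ‖A - X‖ ≤ (1 + ‖G₂ * rightInv G₁‖) ^ ((1 : ℝ) / (2 * (q : ℝ) + 1)) * σ := by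
  set O₁ := O.submatrix Sum.inl id with hO₁
  set O₂ := O.submatrix Sum.inr id with hO₂
  set B := (A * Aᵀ) ^ q * A with hB
  have hOn : ‖Oᵀ‖ ≤ 1 := by
    refine norm_matrix_le zero_le_one fun x => ?_
    have := norm_sq_euclCLM Oᵀ x
    rw [transpose_transpose, hO, euclCLM_one, real_inner_self_eq_norm_sq] at this
    rw [one_mul]
    exact le_of_eq ((sq_eq_sq₀ (norm_nonneg _) (norm_nonneg _)).1 this)
  have hOx : ∀ x, ‖euclCLM O x‖ ≤ ‖x‖ := fun x => by
    have := norm_euclCLM_le O x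
    rw [norm_transpose_matrix] at hOn
    exact this.trans (mul_le_of_le_one_left (norm_nonneg _) hOn)
  have hsq : ∀ x, ‖euclCLM O x‖ ^ 2 = ‖euclCLM O₁ x‖ ^ 2 + ‖euclCLM O₂ x‖ ^ 2 := by
    intro x
    rw [EuclideanSpace.real_norm_sq_eq, EuclideanSpace.real_norm_sq_eq,
      EuclideanSpace.real_norm_sq_eq, Fintype.sum_sum_type]
    rfl
  have hO1x : ∀ x, ‖euclCLM O₁ x‖ ≤ ‖x‖ := fun x =>
    (pow_le_pow_iff_left₀ (norm_nonneg _) (norm_nonneg _) two_ne_zero).1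
      ((by nlinarith [hsq x, sq_nonneg ‖euclCLM O₂ x‖] : ‖euclCLM O₁ x‖ ^ 2 ≤ ‖euclCLM O x‖ ^ 2)
        |>.trans (by gcongr; exact hOx x))
  have hO2x : ∀ x, ‖euclCLM O₂ x‖ ≤ ‖x‖ := fun x =>
    (pow_le_pow_iff_left₀ (norm_nonneg _) (norm_nonneg _) two_ne_zero).1
      ((by nlinarith [hsq x, sq_nonneg ‖euclCLM O₁ x‖] : ‖euclCLM O₂ x‖ ^ 2 ≤ ‖euclCLM O x‖ ^ 2)
        |>.trans (by gcongr; exact hOx x))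
  set T := rightInv G₁ with hT
  have hGT : G₁ * T = 1 := mul_rightInv hdet
  set M := B * R * T * O₁ with hM
  set τ := ‖G₂ * T‖ with hτ
  have hτ0 : 0 ≤ τ := norm_nonneg _
  have hBM : ‖B - M‖ ≤ σ ^ (2 * q + 1) * (1 + τ) := by
    refine norm_matrix_le (by positivity) fun x => ?_
    set y := x - euclCLM (R * T * O₁) x with hy
    have e1 : euclCLM (B - M) x = euclCLM B y := by
      rw [hy, map_sub, ← euclCLM_mul, euclCLM_sub_apply, hM]
      simp only [Matrix.mul_assoc]
    have e2 : euclCLM O₁ y = 0 := by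
      rw [hy, map_sub, ← euclCLM_mul, ← Matrix.mul_assoc, ← Matrix.mul_assoc, hG₁, hGT,
        Matrix.one_mul, sub_self]
    have e3 : euclCLM O₂ y = euclCLM O₂ x - euclCLM (G₂ * T) (euclCLM O₁ x) := by
      rw [hy, map_sub, ← euclCLM_mul, ← euclCLM_mul, ← Matrix.mul_assoc, ← Matrix.mul_assoc, hG₂]
    rw [e1, mul_assoc]
    refine (h y e2).trans (mul_le_mul_of_nonneg_left ?_ (by positivity))
    rw [e3]
    calc _ ≤ ‖euclCLM O₂ x‖ + ‖euclCLM (G₂ * T) (euclCLM O₁ x)‖ := norm_sub_le _ _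
      _ ≤ ‖x‖ + τ * ‖x‖ := add_le_add (hO2x x)
          ((norm_euclCLM_le _ _).trans (mul_le_mul_of_nonneg_left (hO1x x) hτ0))
      _ = _ := by ring
  obtain ⟨Z, hZ⟩ := norm_sub_mul_pow_le A M q
  refine ⟨M * Z, ?_, ?_, ?_⟩
  · calc (M * Z).rank ≤ M.rank := Matrix.rank_mul_le_left _ _
      _ ≤ O₁.rank := Matrix.rank_mul_le_right _ _
      _ ≤ k := by simpa using O₁.rank_le_card_height
  · rintro _ ⟨x, rfl⟩
    refine ⟨(T * O₁ * Z) *ᵥ x, ?_⟩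
    simp only [Matrix.mulVecLin_apply, Matrix.mulVec_mulVec, hM, Matrix.mul_assoc]
  · have h1 := hZ.trans hBM
    have hs : (0 : ℝ) < 2 * q + 1 := by positivity
    have h2 : ((1 + τ) ^ ((1 : ℝ) / (2 * (q : ℝ) + 1)) * σ) ^ (2 * q + 1) =
        σ ^ (2 * q + 1) * (1 + τ) := by
      rw [mul_pow, ← Real.rpow_mul_natCast (by positivity)]
      push_cast
      rw [one_div_mul_cancel hs.ne', Real.rpow_one, mul_comm]
    rw [← h2] at h1
    exact (pow_le_pow_iff_left₀ (norm_nonneg _) (by positivity) (by omega)).1 h1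

end PowerIteration

section GaussianQuotient

open ProbabilityTheory Module
open scoped Matrix.Norms.L2Operator

variable {ι κ l : Type*} [Fintype ι] [Fintype κ] [Fintype l] [DecidableEq ι]

theorem lintegral_norm_mul_rightInv_le [Nonempty ι] [Nonempty l] {p : ℕ} (hp2 : 2 ≤ p)
    (hp : Fintype.card κ = Fintype.card ι + p) :
    ∫⁻ G : ι ⊕ l → κ → ℝ, ENNReal.ofReal
        ‖(Matrix.of fun i => G (Sum.inr i)) * rightInv (Matrix.of fun i => G (Sum.inl i))‖
        ∂(gaussianMat (ι ⊕ l) κ) ≤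
      ENNReal.ofReal (√(Fintype.card ι / ((p : ℝ) - 1)) +
        Real.exp 1 * √((Fintype.card ι : ℝ) + p) / p * √(Fintype.card l)) := by
  have hmp := measurePreserving_sumPiEquivProdPi (ι := ι) (ι' := l) (fun _ => gaussianVec κ)
  have hm : Measurable fun x : (ι → κ → ℝ) × (l → κ → ℝ) =>
      ENNReal.ofReal ‖Matrix.of x.2 * rightInv (Matrix.of x.1)‖ := by
    refine ENNReal.measurable_ofReal.comp (measurable_norm_matrix fun i j => ?_)
    simp only [Matrix.mul_apply, Matrix.of_apply]
    refine Finset.measurable_sum _ fun a _ => Measurable.mul (by fun_prop)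
      ((measurable_rightInv a j).comp measurable_fst)
  have hm1 : Measurable fun G : ι → κ → ℝ => ENNReal.ofReal ‖rightInv (Matrix.of G)‖ :=
    ENNReal.measurable_ofReal.comp (measurable_norm_matrix measurable_rightInv)
  have hm2 : Measurable fun G : ι → κ → ℝ =>
      ENNReal.ofReal √(∑ i, ∑ j, rightInv (Matrix.of G) i j ^ 2) :=
    ENNReal.measurable_ofReal.comp (Finset.measurable_sum _ fun i _ =>
      Finset.measurable_sum _ fun j _ => (measurable_rightInv i j).pow_const 2).sqrt
  have h1 : ∀ T : Matrix κ ι ℝ, ∫⁻ G : l → κ → ℝ, ENNReal.ofReal ‖Matrix.of G * T‖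
      ∂(gaussianMat l κ) ≤ ENNReal.ofReal √(Fintype.card l) * ENNReal.ofReal ‖T‖ +
        ENNReal.ofReal √(∑ i, ∑ j, T i j ^ 2) := by
    intro T
    obtain ⟨hi, hle⟩ := integral_norm_gaussianMat_mul_le (ι := l) T
    rw [← ofReal_integral_eq_lintegral_ofReal hi (.of_forall fun _ => norm_nonneg _),
      ← ENNReal.ofReal_mul (by positivity), ← ENNReal.ofReal_add (by positivity) (by positivity)]
    exact ENNReal.ofReal_le_ofReal hle
  have hp' : (2 : ℝ) ≤ p := by exact_mod_cast hp2
  calc _ = ∫⁻ x, ENNReal.ofReal ‖Matrix.of x.2 * rightInv (Matrix.of x.1)‖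
        ∂((gaussianMat ι κ).prod (gaussianMat l κ)) := by
        rw [← hmp.lintegral_comp hm]
        rfl
    _ = ∫⁻ G₁, ∫⁻ G₂, ENNReal.ofReal ‖Matrix.of G₂ * rightInv (Matrix.of G₁)‖
        ∂(gaussianMat l κ) ∂(gaussianMat ι κ) := lintegral_prod _ hm.aemeasurable
    _ ≤ ∫⁻ G, (ENNReal.ofReal √(Fintype.card l) * ENNReal.ofReal ‖rightInv (Matrix.of G)‖ +
        ENNReal.ofReal √(∑ i, ∑ j, rightInv (Matrix.of G) i j ^ 2)) ∂(gaussianMat ι κ) :=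
        lintegral_mono fun G => h1 _
    _ = ENNReal.ofReal √(Fintype.card l) * ∫⁻ G, ENNReal.ofReal ‖rightInv (Matrix.of G)‖
          ∂(gaussianMat ι κ) + ∫⁻ G, ENNReal.ofReal √(∑ i, ∑ j, rightInv (Matrix.of G) i j ^ 2)
          ∂(gaussianMat ι κ) := by
        rw [lintegral_add_right _ hm2, lintegral_const_mul _ hm1]
    _ ≤ ENNReal.ofReal √(Fintype.card l) *
          ENNReal.ofReal (Real.exp 1 * √((Fintype.card ι : ℝ) + p) / p) +
        ENNReal.ofReal √(Fintype.card ι / ((p : ℝ) - 1)) := by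
        gcongr
        · exact lintegral_norm_rightInv_le (by omega) hp
        · exact lintegral_sqrt_rightInv_sum_sq_le hp hp2
    _ = _ := by
        rw [← ENNReal.ofReal_mul (by positivity), ← ENNReal.ofReal_add (by positivity)
          (by positivity)]
        congr 1
        ring

theorem lintegral_one_add_rpow_le {Ω : Type*} [MeasurableSpace Ω] {μ : Measure Ω}
    [IsProbabilityMeasure μ] {f : Ω → ℝ} (hf : Measurable f) (hf0 : ∀ ω, 0 ≤ f ω) {s c : ℝ}
    (hs : 1 ≤ s) (hc : 0 ≤ c) (h : ∫⁻ ω, ENNReal.ofReal (f ω) ∂μ ≤ ENNReal.ofReal c) :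
    ∫⁻ ω, ENNReal.ofReal ((1 + f ω) ^ (1 / s)) ∂μ ≤ ENNReal.ofReal ((1 + c) ^ (1 / s)) := by
  have hs0 : s ≠ 0 := by linarith
  have hpos : ∀ ω, 0 ≤ 1 + f ω := fun ω => add_nonneg zero_le_one (hf0 ω)
  refine lintegral_ofReal_le_of_rpow (f := fun ω => (1 + f ω) ^ (1 / s)) (s := s)
    ((measurable_const.add hf).pow_const _)
    (fun ω => Real.rpow_nonneg (hpos ω) _) hs (by positivity) ?_
  have hpow : ∀ ω, ((1 + f ω) ^ (1 / s)) ^ s = 1 + f ω := fun ω => by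
    rw [← Real.rpow_mul (hpos ω), one_div_mul_cancel hs0, Real.rpow_one]
  simp only [hpow]
  rw [← Real.rpow_mul (by positivity), one_div_mul_cancel hs0, Real.rpow_one,
    ENNReal.ofReal_add zero_le_one hc]
  have hadd : ∀ ω, ENNReal.ofReal (1 + f ω) = ENNReal.ofReal 1 + ENNReal.ofReal (f ω) :=
    fun ω => ENNReal.ofReal_add zero_le_one (hf0 ω)
  simp only [hadd]
  rw [lintegral_add_left measurable_const, lintegral_const, measure_univ, mul_one]
  gcongr

end GaussianQuotient

/-- **Randomized fast spectral norm SVD with power iteration** (Lemma 6.9 of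
Boutsidis–Drineas–Magdon-Ismail, extending Corollary 10.10 of Halko–Martinsson–Tropp):
let `A ∈ ℝ^{m×n}` have rank `ρ`, let `2 ≤ k < ρ`, `p ≥ 2`, `q ≥ 0`, and `r = k + p`.
If `R` is an `n × r` matrix with i.i.d. standard Gaussian entries, `B = (A Aᵀ)^q A`, and
`Y = B R`, then the expected value of `min {‖A - X‖₂ : rank X ≤ k, col X ⊆ col Y}` is at
most `(1 + √(k/(p-1)) + (e √(k+p)/p) √(min{m,n} - k))^{1/(2q+1)} ‖A - A_k‖₂`. -/
theorem fast_spectral_svd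
    {m n : ℕ} (A : Matrix (Fin m) (Fin n) ℝ) (k p q r : ℕ)
    (hk2 : 2 ≤ k) (hk : k < A.rank) (hp : 2 ≤ p) (hr : r = k + p) :
    (∫ R : Fin n → Fin r → ℝ,
        sInf {e : ℝ | ∃ X : Matrix (Fin m) (Fin n) ℝ, X.rank ≤ k ∧
          LinearMap.range X.mulVecLin ≤
            LinearMap.range ((A * Aᵀ) ^ q * A * Matrix.of R).mulVecLin ∧
          e = spec (A - X)}
      ∂(Measure.pi fun _ : Fin n =>
          Measure.pi fun _ : Fin r => ProbabilityTheory.gaussianReal 0 1)) ≤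
    (1 + Real.sqrt ((k : ℝ) / ((p : ℝ) - 1)) +
        (Real.exp 1 * Real.sqrt ((k : ℝ) + (p : ℝ)) / (p : ℝ)) *
          Real.sqrt ((min m n : ℝ) - (k : ℝ))) ^ ((1 : ℝ) / (2 * (q : ℝ) + 1)) *
      specErr A k := by
  obtain ⟨O, hO, σ, hσ, hσX, hσB⟩ := exists_singular_rows A hk
  have hp' : (2 : ℝ) ≤ p := by exact_mod_cast hp
  have : Nonempty (Fin k) := ⟨⟨0, by omega⟩⟩
  have : Nonempty (Fin (A.rank - k)) := ⟨⟨0, by omega⟩⟩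
  have hspec : ∀ M : Matrix (Fin m) (Fin n) ℝ, 0 ≤ spec M := fun M => norm_nonneg _
  have hσk : σ ≤ specErr A k := by
    refine le_csInf ⟨_, 0, by simp, rfl⟩ ?_
    rintro _ ⟨X, hX, rfl⟩
    exact hσX X hX
  set C := √((k : ℝ) / ((p : ℝ) - 1)) +
    (Real.exp 1 * √((k : ℝ) + (p : ℝ)) / (p : ℝ)) * √((min m n : ℝ) - (k : ℝ)) with hC
  have hC0 : 0 ≤ C := by positivity
  rw [add_assoc, ← hC]
  by_cases hfi : Integrable (fun R : Fin n → Fin r → ℝ =>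
        sInf {e : ℝ | ∃ X : Matrix (Fin m) (Fin n) ℝ, X.rank ≤ k ∧
          LinearMap.range X.mulVecLin ≤
            LinearMap.range ((A * Aᵀ) ^ q * A * Matrix.of R).mulVecLin ∧
          e = spec (A - X)}) (gaussianMat (Fin n) (Fin r))
  swap
  · rw [integral_undef hfi]
    exact mul_nonneg (by positivity) (hσ.trans hσk)
  set Q : (Fin k ⊕ Fin (A.rank - k) → Fin r → ℝ) → ℝ := fun G =>
    spec ((Matrix.of fun i => G (Sum.inr i)) * rightInv (Matrix.of fun i => G (Sum.inl i))) with hQ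
  have hQm : Measurable Q := by
    refine measurable_norm_matrix fun i j => ?_
    simp only [Matrix.mul_apply, Matrix.of_apply]
    exact Finset.measurable_sum _ fun a _ => Measurable.mul (by fun_prop)
      ((measurable_rightInv a j).comp (measurable_pi_iff.2 fun i => measurable_pi_apply _))
  have hQ1 : ∫⁻ G, ENNReal.ofReal (Q G) ∂(gaussianMat (Fin k ⊕ Fin (A.rank - k)) (Fin r)) ≤
      ENNReal.ofReal C := by
    refine (lintegral_norm_mul_rightInv_le hp (by simp [hr])).trans (ENNReal.ofReal_le_ofReal ?_)
    have hN : ((A.rank - k : ℕ) : ℝ) ≤ (min m n : ℝ) - k := by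
      rw [Nat.cast_sub hk.le]
      have h1 : A.rank ≤ m := by simpa using A.rank_le_card_height
      have h2 : A.rank ≤ n := by simpa using A.rank_le_card_width
      have : (A.rank : ℝ) ≤ min (m : ℝ) n := le_min (by exact_mod_cast h1) (by exact_mod_cast h2)
      linarith
    simp only [Fintype.card_fin]
    rw [hC]
    gcongr
  have hs : (1 : ℝ) ≤ 2 * q + 1 := by linarith [(Nat.cast_nonneg q : (0 : ℝ) ≤ q)]
  have hQ2 := lintegral_one_add_rpow_le hQm (fun G => norm_nonneg _) hs hC0 hQ1
  have hmO : Measurable fun (R : Fin n → Fin r → ℝ) i j => (O * Matrix.of R) i j := by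
    refine measurable_pi_iff.2 fun i => measurable_pi_iff.2 fun j => ?_
    simp only [Matrix.mul_apply, Matrix.of_apply]
    fun_prop
  have hdet : ∀ᵐ R ∂(gaussianMat (Fin n) (Fin r)),
      ((O.submatrix Sum.inl id * Matrix.of R) *
        (O.submatrix Sum.inl id * Matrix.of R)ᵀ).det ≠ 0 := by
    have hO₁ : O.submatrix Sum.inl id * (O.submatrix Sum.inl id)ᵀ = 1 := by
      ext i j
      have := congrFun (congrFun hO (Sum.inl i)) (Sum.inl j)
      simpa [Matrix.mul_apply, Matrix.one_apply] using this
    have h := ae_det_mul_transpose_ne_zero (ι := Fin k) (κ := Fin r) (by simp [hr])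
    rw [← map_mul_gaussianMat hO₁] at h
    have hm₁ : Measurable fun (R : Fin n → Fin r → ℝ) i j =>
        (O.submatrix Sum.inl id * Matrix.of R) i j := by
      refine measurable_pi_iff.2 fun i => measurable_pi_iff.2 fun j => ?_
      simp only [Matrix.mul_apply, Matrix.of_apply]
      fun_prop
    exact ae_of_ae_map hm₁.aemeasurable h
  have hmain : ∀ᵐ R ∂(gaussianMat (Fin n) (Fin r)),
      sInf {e : ℝ | ∃ X : Matrix (Fin m) (Fin n) ℝ, X.rank ≤ k ∧
          LinearMap.range X.mulVecLin ≤
            LinearMap.range ((A * Aᵀ) ^ q * A * Matrix.of R).mulVecLin ∧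
          e = spec (A - X)} ≤
      (1 + Q fun i j => (O * Matrix.of R) i j) ^ ((1 : ℝ) / (2 * (q : ℝ) + 1)) * σ := by
    filter_upwards [hdet] with R hR
    obtain ⟨X, hX1, hX2, hX3⟩ := exists_low_rank_approx A hO hσ q (hσB q) (Matrix.of R) rfl rfl hR
    refine csInf_le_of_le ⟨0, ?_⟩ ⟨X, hX1, hX2, rfl⟩ hX3
    rintro _ ⟨X, -, -, rfl⟩
    exact hspec _
  rw [← ENNReal.ofReal_le_ofReal_iff (mul_nonneg (by positivity) (hσ.trans hσk)),
    ofReal_integral_eq_lintegral_ofReal hfi (.of_forall fun R => Real.sInf_nonneg (by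
      rintro _ ⟨X, -, -, rfl⟩
      exact hspec _))]
  have hQ0 : ∀ G, 0 ≤ (1 + Q G) ^ ((1 : ℝ) / (2 * (q : ℝ) + 1)) := fun G =>
    Real.rpow_nonneg (add_nonneg zero_le_one (norm_nonneg _)) _
  calc _ ≤ ∫⁻ R, ENNReal.ofReal ((1 + Q fun i j => (O * Matrix.of R) i j) ^
          ((1 : ℝ) / (2 * (q : ℝ) + 1)) * σ) ∂(gaussianMat (Fin n) (Fin r)) :=
        lintegral_mono_ae (hmain.mono fun R hR => ENNReal.ofReal_le_ofReal hR)
    _ = ∫⁻ G, ENNReal.ofReal ((1 + Q G) ^ ((1 : ℝ) / (2 * (q : ℝ) + 1)) * σ)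
          ∂(gaussianMat (Fin k ⊕ Fin (A.rank - k)) (Fin r)) := by
        rw [← map_mul_gaussianMat hO, lintegral_map _ hmO]
        fun_prop
    _ = (∫⁻ G, ENNReal.ofReal ((1 + Q G) ^ ((1 : ℝ) / (2 * (q : ℝ) + 1)))
          ∂(gaussianMat (Fin k ⊕ Fin (A.rank - k)) (Fin r))) * ENNReal.ofReal σ := by
        simp only [ENNReal.ofReal_mul (hQ0 _)]
        rw [lintegral_mul_const]
        fun_prop
    _ ≤ ENNReal.ofReal ((1 + C) ^ ((1 : ℝ) / (2 * (q : ℝ) + 1))) * ENNReal.ofReal σ := by gcongr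
    _ ≤ _ := by
        rw [← ENNReal.ofReal_mul (by positivity)]
        gcongr
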